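/- Let X_free be a compact, path-connected subset of ℝ² equal to a finite union of convex polygons. Let σ_s be a path in X_free of finite cost, and let σ* be an optimal homotopic path in X_free of finite cost with σ*(0) = σ_s(1) that is parametrized proportionally to arc length (c(σ*_{[0,t]}) = t·c(σ*) for all t ∈ [0,1]). Define g(t) := m[σ_s * σ*_{[0,t]}] for t ∈ [0,1]. Then g is a convex function on [0,1]. -/

import Mathlib

noncomputable section

/-- Points of the plane. -/
abbrev E2 : Type := EuclideanSpace ℝ (Fin 2)

namespace THPP

lemma subIcc_mem (s t₁ t₂ : unitInterval) :
    (1 - s.1) * t₁.1 + s.1 * t₂.1 ∈ Set.Icc (0 : ℝ) 1 := by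
  have hs0 : (0:ℝ) ≤ s.1 := s.2.1
  have hs1 : s.1 ≤ 1 := s.2.2
  have ha0 : (0:ℝ) ≤ t₁.1 := t₁.2.1
  have ha1 : t₁.1 ≤ 1 := t₁.2.2
  have hb0 : (0:ℝ) ≤ t₂.1 := t₂.2.1
  have hb1 : t₂.1 ≤ 1 := t₂.2.2
  constructor
  · have h1 := mul_nonneg (by linarith : (0:ℝ) ≤ 1 - s.1) ha0
    have h2 := mul_nonneg hs0 hb0
    linarith
  · have h1 := mul_nonneg (by linarith : (0:ℝ) ≤ 1 - s.1) (by linarith : (0:ℝ) ≤ 1 - t₁.1)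
    have h2 := mul_nonneg hs0 (by linarith : (0:ℝ) ≤ 1 - t₂.1)
    nlinarith

/-- The subpath `σ_{[t₁,t₂]} : s ↦ σ ((1-s)·t₁ + s·t₂)`. -/
def subpath {Y : Type*} [TopologicalSpace Y] {a b : Y} (σ : Path a b) (t₁ t₂ : unitInterval) :
    Path (σ t₁) (σ t₂) where
  toFun s := σ ⟨(1 - s.1) * t₁.1 + s.1 * t₂.1, subIcc_mem s t₁ t₂⟩
  continuous_toFun := σ.continuous.comp (Continuous.subtype_mk (by fun_prop) _)
  source' := by
    exact congrArg (fun u => σ u) (Subtype.ext (by simp))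
  target' := by
    exact congrArg (fun u => σ u) (Subtype.ext (by simp))

/-- The subpath `σ_{[0,t]}`, as a path from the start point of `σ` to `σ t`. -/
def subpath0 {Y : Type*} [TopologicalSpace Y] {a b : Y} (σ : Path a b) (t : unitInterval) :
    Path a (σ t) :=
  (subpath σ 0 t).cast σ.source.symm rfl

/-- The straight-line path `t ↦ (1-t)·x₀ + t·x₁`, as a path in `X` given that the
segment `[x₀, x₁]` is contained in `X`. -/
def linePath {X : Set E2} {x₀ x₁ : E2} (h₀ : x₀ ∈ X) (h₁ : x₁ ∈ X)
    (hseg : segment ℝ x₀ x₁ ⊆ X) : Path (⟨x₀, h₀⟩ : X) ⟨x₁, h₁⟩ where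
  toFun t := ⟨(1 - t.1) • x₀ + t.1 • x₁,
    hseg (by rw [segment_eq_image]; exact ⟨t.1, t.2, rfl⟩)⟩
  continuous_toFun := Continuous.subtype_mk (by fun_prop) _
  source' := Subtype.ext (by simp)
  target' := Subtype.ext (by simp)

/-- The cost (arc length) of a path in a subset of the plane: the total variation of the
underlying map `[0,1] → ℝ²`. -/
def cost {X : Set E2} {a b : X} (σ : Path a b) : ENNReal :=
  eVariationOn (fun t => (σ t : E2)) Set.univ

/-- A path is an optimal homotopic path if it has minimal cost within its
path-homotopy class (homotopies staying in `X`). -/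
def IsOptimal {X : Set E2} {a b : X} (σ : Path a b) : Prop :=
  ∀ σ' : Path a b, σ.Homotopic σ' → cost σ ≤ cost σ'

/-- `m[σ]`: the infimal cost of the path-homotopy class of `σ`. -/
def mCost {X : Set E2} {a b : X} (σ : Path a b) : ENNReal :=
  ⨅ σ' : {σ' : Path a b // σ.Homotopic σ'}, cost σ'.1

/-- Concatenation `σ₀ * σ₁ * ⋯ * σ_{n-1}` of a chain of paths. -/
def chain {Y : Type*} [TopologicalSpace Y] (x : ℕ → Y)
    (σ : ∀ i : ℕ, Path (x i) (x (i + 1))) : ∀ n : ℕ, Path (x 0) (x n)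
  | 0 => Path.refl (x 0)
  | n + 1 => (chain x σ n).trans (σ n)

/-! ### Planar cones -/

/-- mutual visibility in a cone -/
def Vis (C : Set E2) (x y : E2) : Prop := ∀ a b : ℝ, 0 ≤ a → 0 ≤ b → a • x + b • y ∈ C

def IsCn (C : Set E2) : Prop := ∀ x ∈ C, ∀ s : ℝ, 0 ≤ s → s • x ∈ C

open Classical in
/-- cone distance -/
def cd (C : Set E2) (x y : E2) : ℝ := if Vis C x y then ‖x - y‖ else ‖x‖ + ‖y‖

lemma Vis.symm {C : Set E2} {x y : E2} (h : Vis C x y) : Vis C y x := by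
  intro a b ha hb
  rw [add_comm]; exact h b a hb ha

lemma vis_zero {C : Set E2} (hC : IsCn C) {x : E2} (hx : x ∈ C) : Vis C 0 x := by
  intro a b _ hb
  simpa using hC x hx b hb

lemma vis_smul {C : Set E2} {x y : E2} (h : Vis C x y) {s : ℝ} (hs : 0 ≤ s) : Vis C x (s • y) := by
  intro a b ha hb
  rw [smul_smul]; exact h a _ ha (mul_nonneg hb hs)

lemma vis_self {C : Set E2} (hC : IsCn C) {x : E2} (hx : x ∈ C) : Vis C x x := by
  intro a b ha hb
  rw [← add_smul]; exact hC x hx _ (add_nonneg ha hb)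

lemma vis_comb {C : Set E2} {x y z : E2} (h : Vis C x y) {a b : ℝ} (ha : 0 ≤ a) (hb : 0 ≤ b)
    (hz : z = a • x + b • y) : Vis C y z := by
  intro c d hc hd
  have : c • y + d • z = (d * a) • x + (c + d * b) • y := by rw [hz]; module
  rw [this]; exact h _ _ (by positivity) (by positivity)

lemma vis_between {C : Set E2} {x y z : E2} (hxy : Vis C x y) (hxz : Vis C x z) (hx0 : x ≠ 0)
    {b c : ℝ} (hb : 0 ≤ b) (hc : 0 ≤ c) (hx : x = b • y + c • z) : Vis C y z := by
  intro p q hp hq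
  rcases le_total (q * b) (p * c) with h | h
  · rcases hc.eq_or_lt with hc0 | hc0
    · have hb0 : b ≠ 0 := by
        rintro rfl; apply hx0; rw [hx, ← hc0]; simp
      have hb0' : 0 < b := lt_of_le_of_ne hb (Ne.symm hb0)
      have hq0 : q = 0 := by
        rw [← hc0] at h; nlinarith
      have : p • y + q • z = (p / b) • x + (0:ℝ) • z := by
        rw [hx, ← hc0, hq0]; simp [smul_smul, div_mul_cancel₀ _ hb0]
      rw [this]; exact hxz _ _ (by positivity) le_rfl
    · have : p • y + q • z = (q / c) • x + (p - q * b / c) • y := by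
        rw [hx, smul_add, smul_smul, smul_smul, div_mul_cancel₀ _ hc0.ne']; module
      rw [this]; refine hxy _ _ (by positivity) ?_
      rw [sub_nonneg, div_le_iff₀ hc0]; exact h
  · rcases hb.eq_or_lt with hb0 | hb0
    · have hc0 : c ≠ 0 := by
        rintro rfl; apply hx0; rw [hx, ← hb0]; simp
      have hc0' : 0 < c := lt_of_le_of_ne hc (Ne.symm hc0)
      have hp0 : p = 0 := by
        rw [← hb0] at h; nlinarith
      have : p • y + q • z = (q / c) • x + (0:ℝ) • y := by
        rw [hx, ← hb0, hp0]; simp [smul_smul, div_mul_cancel₀ _ hc0]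
      rw [this]; exact hxy _ _ (by positivity) le_rfl
    · have : p • y + q • z = (p / b) • x + (q - p * c / b) • z := by
        rw [hx, smul_add, smul_smul, smul_smul, div_mul_cancel₀ _ hb0.ne']; module
      rw [this]; refine hxz _ _ (by positivity) ?_
      rw [sub_nonneg, div_le_iff₀ hb0]; exact h

lemma cone_opp {x y z : E2} (hy : y ≠ 0) (hz : z ≠ 0) {a b c : ℝ} (ha : 0 ≤ a) (hb : 0 ≤ b)
    (hc : 0 ≤ c) (hne : ¬ (a = 0 ∧ b = 0 ∧ c = 0)) (h : a • x + b • y + c • z = 0) :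
    ‖z‖ * inner ℝ y x + ‖y‖ * inner ℝ z x ≤ 0 := by
  have hy0 : 0 < ‖y‖ := norm_pos_iff.2 hy
  have hz0 : 0 < ‖z‖ := norm_pos_iff.2 hz
  have hcs : -(‖y‖ * ‖z‖) ≤ inner ℝ y z := by
    have := abs_real_inner_le_norm y z
    exact (abs_le.1 this).1
  rcases ha.eq_or_lt with ha0 | ha0
  · have h' : b • y + c • z = 0 := by rw [← ha0] at h; simpa using h
    have hb0 : b ≠ 0 := by
      rintro rfl
      have : c = 0 := by
        by_contra hc0
        simp [hc0, hz] at h'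
      exact hne ⟨ha0.symm, rfl, this⟩
    have hb0' : 0 < b := lt_of_le_of_ne hb (Ne.symm hb0)
    have hyz : b • y = -(c • z) := eq_neg_of_add_eq_zero_left h'
    have hn : b * ‖y‖ = c * ‖z‖ := by
      have := congrArg norm hyz
      rwa [norm_neg, norm_smul, norm_smul, Real.norm_of_nonneg hb, Real.norm_of_nonneg hc] at this
    have hi : b * inner ℝ y x = - (c * inner ℝ z x) := by
      have := congrArg (fun w => inner ℝ w x) hyz
      simpa [inner_smul_left, inner_neg_left] using this
    have : b * (‖z‖ * inner ℝ y x + ‖y‖ * inner ℝ z x) = 0 := by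
      linear_combination ‖z‖ * hi + inner ℝ z x * hn
    rcases mul_eq_zero.1 this with h | h
    · exact absurd h hb0
    · exact h.le
  · have hx : a • x = - (b • y + c • z) := by
      rw [eq_neg_iff_add_eq_zero, ← add_assoc]; exact h
    have hiy : a * inner ℝ y x = - (b * (‖y‖ * ‖y‖) + c * inner ℝ y z) := by
      have := congrArg (fun w => inner ℝ y w) hx
      simp only [inner_smul_right, inner_neg_right, inner_add_right,
        real_inner_self_eq_norm_mul_norm] at this
      exact this
    have hiz : a * inner ℝ z x = - (b * inner ℝ y z + c * (‖z‖ * ‖z‖)) := by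
      have := congrArg (fun w => inner ℝ z w) hx
      simp only [inner_smul_right, inner_neg_right, inner_add_right,
        real_inner_self_eq_norm_mul_norm] at this
      rw [real_inner_comm z y]
      exact this
    have key : a * (‖z‖ * inner ℝ y x + ‖y‖ * inner ℝ z x) ≤ 0 := by
      have e : a * (‖z‖ * inner ℝ y x + ‖y‖ * inner ℝ z x)
        = - ((b * ‖y‖ + c * ‖z‖) * (‖y‖ * ‖z‖ + inner ℝ y z)) := by
        linear_combination ‖z‖ * hiy + ‖y‖ * hiz
      rw [e, neg_nonpos]
      exact mul_nonneg (by positivity) (by linarith)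
    by_contra hcon
    push Not at hcon
    nlinarith [mul_pos ha0 hcon]

lemma exists_rel (x y z : E2) : ∃ a b c : ℝ, ¬ (a = 0 ∧ b = 0 ∧ c = 0) ∧
    a • x + b • y + c • z = 0 := by
  have h : ¬ LinearIndependent ℝ ![x, y, z] := by
    intro h
    have := h.fintype_card_le_finrank
    simp at this
  rw [Fintype.not_linearIndependent_iff] at h
  obtain ⟨g, hg, i, hi⟩ := h
  refine ⟨g 0, g 1, g 2, ?_, ?_⟩
  · rintro ⟨h0, h1, h2⟩
    fin_cases i <;> simp_all
  · simpa [Fin.sum_univ_three] using hg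

/-- The key lemma. -/
lemma key_cone {C : Set E2} {x y z : E2} (hxy : Vis C x y) (hxz : Vis C x z)
    (hyz : ¬ Vis C y z) : ‖z‖ * inner ℝ y x + ‖y‖ * inner ℝ z x ≤ 0 := by
  by_cases hx0 : x = 0
  · simp [hx0]
  have hy : y ≠ 0 := by
    rintro rfl
    apply hyz; intro a b ha hb
    simpa using hxz 0 b le_rfl hb
  have hz : z ≠ 0 := by
    rintro rfl
    apply hyz; intro a b ha hb
    simpa using hxy 0 a le_rfl ha
  have A : ∀ a b c : ℝ, 0 ≤ a → 0 ≤ b → ¬ (a = 0 ∧ b = 0 ∧ c = 0) →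
      a • x + b • y + c • z = 0 → ‖z‖ * inner ℝ y x + ‖y‖ * inner ℝ z x ≤ 0 := by
    intro a b c ha hb hne h
    rcases le_or_gt 0 c with hc | hc
    · exact cone_opp hy hz ha hb hc hne h
    · exfalso; apply hyz
      have hz' : z = (a / (-c)) • x + (b / (-c)) • y := by
        have : (-c) • z = a • x + b • y := by
          rw [neg_smul]; exact neg_eq_of_add_eq_zero_left h
        rw [← inv_smul_smul₀ (neg_ne_zero.2 hc.ne) z, this, smul_add, smul_smul, smul_smul]
        congr 2 <;> ring
      exact vis_comb hxy (div_nonneg ha (by linarith)) (div_nonneg hb (by linarith)) hz'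
  have B : ∀ a b c : ℝ, 0 ≤ a → 0 ≤ c → b < 0 →
      a • x + b • y + c • z = 0 → False := by
    intro a b c ha hc hb h
    apply hyz
    have hy' : y = (a / (-b)) • x + (c / (-b)) • z := by
      have : (-b) • y = a • x + c • z := by
        rw [neg_smul]; apply neg_eq_of_add_eq_zero_left; rw [← h]; abel
      rw [← inv_smul_smul₀ (neg_ne_zero.2 hb.ne) y, this, smul_add, smul_smul, smul_smul]
      congr 2 <;> ring
    exact (vis_comb hxz (div_nonneg ha (by linarith)) (div_nonneg hc (by linarith)) hy').symm
  have D : ∀ a b c : ℝ, 0 ≤ b → 0 ≤ c → a < 0 →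
      a • x + b • y + c • z = 0 → False := by
    intro a b c hb hc ha h
    apply hyz
    have hx' : x = (b / (-a)) • y + (c / (-a)) • z := by
      have : (-a) • x = b • y + c • z := by
        rw [neg_smul]; apply neg_eq_of_add_eq_zero_left; rw [← h]; abel
      rw [← inv_smul_smul₀ (neg_ne_zero.2 ha.ne) x, this, smul_add, smul_smul, smul_smul]
      congr 2 <;> ring
    exact vis_between hxy hxz hx0 (div_nonneg hb (by linarith)) (div_nonneg hc (by linarith)) hx'
  obtain ⟨a, b, c, hne, h⟩ := exists_rel x y z
  have h' : (-a) • x + (-b) • y + (-c) • z = 0 := by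
    have : (-a) • x + (-b) • y + (-c) • z = -(a • x + b • y + c • z) := by module
    rw [this, h, neg_zero]
  have hne' : ¬ (-a = 0 ∧ -b = 0 ∧ -c = 0) := by simpa using hne
  rcases le_or_gt 0 a with ha | ha <;> rcases le_or_gt 0 b with hb | hb
  · exact A a b c ha hb hne h
  · rcases le_or_gt 0 c with hc | hc
    · exact (B a b c ha hc hb h).elim
    · rcases ha.eq_or_lt with ha0 | ha0
      · exact A (-a) (-b) (-c) (by linarith) (by linarith) hne' h'
      · exact (D (-a) (-b) (-c) (by linarith) (by linarith) (by linarith) h').elim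
  · rcases le_or_gt 0 c with hc | hc
    · exact (D a b c hb hc ha h).elim
    · rcases hb.eq_or_lt with hb0 | hb0
      · exact A (-a) (-b) (-c) (by linarith) (by linarith) hne' h'
      · exact (B (-a) (-b) (-c) (by linarith) (by linarith) (by linarith) h').elim
  · exact A (-a) (-b) (-c) (by linarith) (by linarith) hne' h'

lemma cd_of_vis {C : Set E2} {x y : E2} (h : Vis C x y) : cd C x y = ‖x - y‖ := by
  simp [cd, h]

lemma cd_of_not {C : Set E2} {x y : E2} (h : ¬ Vis C x y) : cd C x y = ‖x‖ + ‖y‖ := by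
  simp [cd, h]

lemma cd_symm (C : Set E2) (x y : E2) : cd C x y = cd C y x := by
  by_cases h : Vis C x y
  · rw [cd_of_vis h, cd_of_vis h.symm, norm_sub_rev]
  · rw [cd_of_not h, cd_of_not (fun h' => h h'.symm), add_comm]

lemma cd_le (C : Set E2) (x y : E2) : cd C x y ≤ ‖x‖ + ‖y‖ := by
  by_cases h : Vis C x y
  · rw [cd_of_vis h]; exact norm_sub_le _ _
  · rw [cd_of_not h]

lemma le_cd (C : Set E2) (x y : E2) : ‖x - y‖ ≤ cd C x y := by
  by_cases h : Vis C x y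
  · rw [cd_of_vis h]
  · rw [cd_of_not h]; exact norm_sub_le _ _

lemma cd_nonneg (C : Set E2) (x y : E2) : 0 ≤ cd C x y := (norm_nonneg _).trans (le_cd C x y)

lemma not_vis_ne {C : Set E2} (hC : IsCn C) {x y : E2} (hy : y ∈ C) (h : ¬ Vis C x y) :
    x ≠ 0 := by
  rintro rfl; exact h (vis_zero hC hy)

lemma norm_sub_ge_of_inner {u x : E2} (hx : x ≠ 0) : ‖x‖ - inner ℝ x u / ‖x‖ ≤ ‖x - u‖ := by
  have h0 : 0 < ‖x‖ := norm_pos_iff.2 hx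
  have h := real_inner_le_norm x (x - u)
  rw [inner_sub_right, real_inner_self_eq_norm_mul_norm] at h
  have : ‖x‖ - inner ℝ x u / ‖x‖ = (‖x‖ * ‖x‖ - inner ℝ x u) / ‖x‖ := by
    field_simp
  rw [this, div_le_iff₀ h0]; linarith

lemma key_cone' {C : Set E2} (hC : IsCn C) {x y z : E2} (hy : y ∈ C) (hz : z ∈ C)
    (hxy : Vis C x y) (hxz : Vis C x z)
    (hyz : ¬ Vis C y z) : inner ℝ y x / ‖y‖ + inner ℝ z x / ‖z‖ ≤ 0 := by
  have h1 := norm_pos_iff.2 (not_vis_ne hC hz hyz)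
  have h2 := norm_pos_iff.2 (not_vis_ne hC hy (fun h => hyz h.symm))
  have h := key_cone hxy hxz hyz
  rw [div_add_div _ _ h1.ne' h2.ne']
  apply div_nonpos_of_nonpos_of_nonneg _ (by positivity)
  linarith

lemma cd_triangle {C : Set E2} (hC : IsCn C) {x y z : E2} (hx : x ∈ C) (hz : z ∈ C) :
    cd C x z ≤ cd C x y + cd C y z := by
  by_cases hxz : Vis C x z
  · rw [cd_of_vis hxz]
    have := norm_sub_le_norm_sub_add_norm_sub x y z
    linarith [le_cd C x y, le_cd C y z]
  rw [cd_of_not hxz]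
  by_cases hxy : Vis C x y <;> by_cases hyz : Vis C y z
  · rw [cd_of_vis hxy, cd_of_vis hyz]
    have h := key_cone' hC hx hz hxy.symm hyz hxz
    have h1 := norm_sub_ge_of_inner (u := y) (not_vis_ne hC hz hxz)
    have h2 := norm_sub_ge_of_inner (u := y) (not_vis_ne hC hx (fun h => hxz h.symm))
    rw [norm_sub_rev z y] at h2
    linarith
  · rw [cd_of_vis hxy, cd_of_not hyz]
    have := norm_sub_norm_le x y
    linarith
  · rw [cd_of_not hxy, cd_of_vis hyz]
    have := norm_sub_norm_le z y
    rw [norm_sub_rev] at this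
    linarith
  · rw [cd_of_not hxy, cd_of_not hyz]
    linarith [norm_nonneg y]

lemma median (x y z : E2) : ‖x - (1/2 : ℝ) • (y + z)‖ ^ 2 =
    1/2 * ‖x - y‖ ^ 2 + 1/2 * ‖x - z‖ ^ 2 - 1/4 * ‖y - z‖ ^ 2 := by
  have h1 : x - (1/2 : ℝ) • (y + z) = (1/2 : ℝ) • ((x - y) + (x - z)) := by module
  have h2 : y - z = (x - z) - (x - y) := by abel
  rw [h1, h2, norm_smul, mul_pow, norm_add_sq_real, norm_sub_sq_real (x - z) (x - y),
    real_inner_comm (x - z) (x - y)]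
  norm_num
  ring

lemma cd_tri_fill {C : Set E2} (hC : IsCn C) {x y z : E2} (hx : x ∈ C)
    (hxy : Vis C x y) (hxz : Vis C x z) (hyz : Vis C y z) :
    Vis C x ((1/2 : ℝ) • (y + z)) := by
  set m := (1/2 : ℝ) • (y + z) with hm
  have hym : Vis C y m := vis_comb hyz.symm (a := 1/2) (b := 1/2) (by norm_num) (by norm_num)
    (by rw [hm]; module)
  have hzm : Vis C z m := vis_comb hyz (a := 1/2) (b := 1/2) (by norm_num) (by norm_num)
    (by rw [hm]; module)
  by_contra hxm
  have hmC : m ∈ C := by simpa using hym 0 1 le_rfl zero_le_one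
  have hx0 := norm_pos_iff.2 (not_vis_ne hC hmC hxm)
  have hm0 := norm_pos_iff.2 (not_vis_ne hC hx (fun h => hxm h.symm))
  have k1 := key_cone hxy.symm hym hxm
  have k2 := key_cone hxz.symm hzm hxm
  -- sum : ‖m‖⟨x,2m⟩ + ‖x‖ ⟨m,2m⟩ ≤ 0
  have hyz' : y + z = (2:ℝ) • m := by rw [hm]; module
  have s1 : inner ℝ x y + inner ℝ x z = 2 * inner ℝ x m := by
    rw [← inner_add_right, hyz', inner_smul_right]
  have s2 : inner ℝ m y + inner ℝ m z = 2 * (‖m‖ * ‖m‖) := by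
    rw [← inner_add_right, hyz', inner_smul_right, real_inner_self_eq_norm_mul_norm]
  have hle : inner ℝ x m + ‖x‖ * ‖m‖ ≤ 0 := by
    have : ‖m‖ * (inner ℝ x m + ‖x‖ * ‖m‖) ≤ 0 := by nlinarith
    by_contra hcon; push Not at hcon
    nlinarith [mul_pos hm0 hcon]
  have heq : inner ℝ x (-m) = ‖x‖ * ‖-m‖ := by
    rw [inner_neg_right, norm_neg]
    have := (abs_le.1 (abs_real_inner_le_norm x m)).1
    linarith
  rw [inner_eq_norm_mul_iff_real, norm_neg] at heq
  -- ‖m‖ • x = ‖x‖ • (-m)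
  apply hxm
  intro a b ha hb
  obtain ⟨k, hk, hxm'⟩ : ∃ k : ℝ, 0 < k ∧ x = (-k) • m := by
    refine ⟨‖x‖ / ‖m‖, by positivity, ?_⟩
    calc x = ‖m‖⁻¹ • ‖m‖ • x := (inv_smul_smul₀ hm0.ne' x).symm
      _ = (-(‖x‖ / ‖m‖)) • m := by
        rw [heq, smul_smul, smul_neg, neg_smul, div_eq_inv_mul]
  rcases le_total (a * k) b with h | h
  · have : a • x + b • m = (b - a * k) • m := by
      rw [hxm']; module
    rw [this]; exact hC m hmC _ (by linarith)
  · have hmx : m = (-k⁻¹) • x := by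
      rw [hxm', smul_smul]
      have : -k⁻¹ * -k = 1 := by field_simp
      rw [this, one_smul]
    have : a • x + b • m = (a - b * k⁻¹) • x := by
      rw [hmx]; module
    rw [this]; refine hC x hx _ ?_
    rw [sub_nonneg, ← div_eq_mul_inv, div_le_iff₀ hk]
    exact h

/-- CN inequality in planar cones. -/
lemma cone_CN {C : Set E2} (hC : IsCn C) {y z : E2} (hy : y ∈ C) (hz : z ∈ C) :
    ∃ m ∈ C, ‖m‖ ≤ max ‖y‖ ‖z‖ ∧ cd C y m ≤ cd C y z / 2 ∧ cd C z m ≤ cd C y z / 2 ∧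
      ∀ x ∈ C, cd C x m ^ 2 ≤ 1/2 * cd C x y ^ 2 + 1/2 * cd C x z ^ 2 - 1/4 * cd C y z ^ 2 := by
  by_cases hyz : Vis C y z
  · set m := (1/2 : ℝ) • (y + z) with hm
    have hym : Vis C y m := vis_comb hyz.symm (a := 1/2) (b := 1/2) (by norm_num) (by norm_num)
      (by rw [hm]; module)
    have hzm : Vis C z m := vis_comb hyz (a := 1/2) (b := 1/2) (by norm_num) (by norm_num)
      (by rw [hm]; module)
    have hmC : m ∈ C := by simpa using hym 0 1 le_rfl zero_le_one
    have hmn : 2 * ‖m‖ = ‖y + z‖ := by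
      rw [hm, norm_smul]; norm_num; ring
    refine ⟨m, hmC, ?_, ?_, ?_, ?_⟩
    · have := norm_add_le y z
      have := le_max_left ‖y‖ ‖z‖
      have := le_max_right ‖y‖ ‖z‖
      linarith
    · rw [cd_of_vis hym, cd_of_vis hyz]
      have : y - m = (1/2 : ℝ) • (y - z) := by rw [hm]; module
      rw [this, norm_smul]; norm_num; linarith
    · rw [cd_of_vis hzm, cd_of_vis hyz]
      have : z - m = (-1/2 : ℝ) • (y - z) := by rw [hm]; module
      rw [this, norm_smul]; norm_num; linarith
    · intro x hx
      rw [cd_of_vis hyz]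
      have med := median x y z
      rw [← hm] at med
      have q1 := pow_le_pow_left₀ (norm_nonneg _) (le_cd C x y) 2
      have q2 := pow_le_pow_left₀ (norm_nonneg _) (le_cd C x z) 2
      by_cases hxm : Vis C x m
      · rw [cd_of_vis hxm, med]; linarith
      rw [cd_of_not hxm]
      have med0 := median 0 y z
      rw [← hm] at med0
      simp only [zero_sub, norm_neg] at med0
      have hm0 := norm_pos_iff.2 (not_vis_ne hC hx (fun h => hxm h.symm))
      have hx0 := norm_pos_iff.2 (not_vis_ne hC hmC hxm)
      have sub : ∀ y z : E2, y + z = (2:ℝ) • m → Vis C y m → Vis C x y →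
          2 * ‖m‖ * ‖x‖ ≤ ‖x‖ * ‖z‖ - inner ℝ x y := by
        intro y z hyz' hym hxy
        have k := key_cone hxy.symm hym hxm
        have e : 2 * (‖m‖ * ‖m‖) = inner ℝ m y + inner ℝ m z := by
          rw [← inner_add_right, hyz', inner_smul_right, real_inner_self_eq_norm_mul_norm]
        have cs := real_inner_le_norm m z
        have : ‖m‖ * (2 * ‖m‖ * ‖x‖) ≤ ‖m‖ * (‖x‖ * ‖z‖ - inner ℝ x y) := by
          nlinarith
        exact le_of_mul_le_mul_left this hm0
      have hyz' : y + z = (2:ℝ) • m := by rw [hm]; module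
      by_cases hxy : Vis C x y <;> by_cases hxz : Vis C x z
      · exact absurd (cd_tri_fill hC hx hxy hxz hyz) hxm
      · rw [cd_of_vis hxy, cd_of_not hxz]
        have := sub y z hyz' hym hxy
        rw [norm_sub_sq_real]
        nlinarith
      · rw [cd_of_not hxy, cd_of_vis hxz]
        have := sub z y (by rw [add_comm]; exact hyz') hzm hxz
        rw [norm_sub_sq_real]
        nlinarith
      · rw [cd_of_not hxy, cd_of_not hxz]
        have := norm_add_le y z
        nlinarith
  · have main : ∀ y z : E2, y ∈ C → z ∈ C → ¬ Vis C y z → ‖z‖ ≤ ‖y‖ → 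
      ∃ m ∈ C, ‖m‖ ≤ max ‖y‖ ‖z‖ ∧ cd C y m ≤ cd C y z / 2 ∧ cd C z m ≤ cd C y z / 2 ∧
      ∀ x ∈ C, cd C x m ^ 2 ≤ 1/2 * cd C x y ^ 2 + 1/2 * cd C x z ^ 2 - 1/4 * cd C y z ^ 2 := by
      clear hyz hy hz y z
      intro y z hy hz hyz hle
      have hy0 := norm_pos_iff.2 (not_vis_ne hC hz hyz)
      have hz0 := norm_pos_iff.2 (not_vis_ne hC hy (fun h => hyz h.symm))
      set l : ℝ := (‖y‖ - ‖z‖) / (2 * ‖y‖) with hl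
      have hl0 : 0 ≤ l := div_nonneg (by linarith) (by positivity)
      have hly : l * ‖y‖ = (‖y‖ - ‖z‖) / 2 := by rw [hl]; field_simp
      have hly2 : (1 - l) * ‖y‖ = (‖y‖ + ‖z‖) / 2 := by linarith
      have hl1 : 0 ≤ 1 - l := by nlinarith
      have hnm : ‖l • y‖ = (‖y‖ - ‖z‖) / 2 := by
        rw [norm_smul, Real.norm_of_nonneg hl0, hly]
      refine ⟨l • y, hC y hy l hl0, ?_, ?_, ?_, ?_⟩
      · rw [hnm]; have := le_max_left ‖y‖ ‖z‖; linarith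
      · rw [cd_of_not hyz, cd_of_vis (vis_smul (vis_self hC hy) hl0)]
        have : y - l • y = (1 - l) • y := by module
        rw [this, norm_smul, Real.norm_of_nonneg hl1, hly2]
      · rw [cd_of_not hyz]
        have := cd_le C z (l • y)
        rw [hnm] at this; linarith
      · intro x hx
        rw [cd_of_not hyz]
        by_cases hxy : Vis C x y
        · rw [cd_of_vis (vis_smul hxy hl0), cd_of_vis hxy]
          set z' := (-(‖z‖ / ‖y‖)) • y with hz'
          have hm : l • y = (1/2 : ℝ) • (y + z') := by
            rw [hz', ← sub_eq_zero]
            have : l • y - (1/2 : ℝ) • (y + (-(‖z‖ / ‖y‖)) • y)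
              = (l - 1/2 * (1 - ‖z‖ / ‖y‖)) • y := by module
            rw [this]
            have : l - 1/2 * (1 - ‖z‖ / ‖y‖) = 0 := by rw [hl]; field_simp; ring
            rw [this, zero_smul]
          rw [hm, median]
          have hd : ‖y - z'‖ = ‖y‖ + ‖z‖ := by
            have : y - z' = (1 + ‖z‖ / ‖y‖) • y := by rw [hz']; module
            rw [this, norm_smul, Real.norm_of_nonneg (by positivity)]; field_simp
          rw [hd]
          have hnz' : ‖z'‖ = ‖z‖ := by
            rw [hz', norm_smul, norm_neg, norm_div, norm_norm, norm_norm]; field_simp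
          have : ‖x - z'‖ ^ 2 ≤ cd C x z ^ 2 := by
            by_cases hxz : Vis C x z
            · rw [cd_of_vis hxz, norm_sub_sq_real, norm_sub_sq_real, hnz']
              have k := key_cone hxy hxz hyz
              have : inner ℝ x z' = -(‖z‖ / ‖y‖) * inner ℝ x y := by
                rw [hz', inner_smul_right]
              rw [this]
              rw [real_inner_comm, real_inner_comm x z] at k
              have : inner ℝ x z ≤ -(‖z‖ / ‖y‖) * inner ℝ x y := by
                rw [neg_mul, div_mul_eq_mul_div, le_neg, div_le_iff₀ hy0]
                linarith
              linarith
            · rw [cd_of_not hxz]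
              have := norm_sub_le x z'
              rw [hnz'] at this
              exact pow_le_pow_left₀ (norm_nonneg _) this 2
          linarith
        · rw [cd_of_not hxy]
          have h1 := cd_le C x (l • y)
          rw [hnm] at h1
          have h1' := pow_le_pow_left₀ (cd_nonneg _ _ _) h1 2
          have h2 : (‖x‖ - ‖z‖) ^ 2 ≤ cd C x z ^ 2 := by
            apply sq_le_sq'
            · have := norm_sub_norm_le z x
              rw [norm_sub_rev] at this
              linarith [le_cd C x z]
            · linarith [norm_sub_norm_le x z, le_cd C x z]
          nlinarith
    rcases le_total ‖z‖ ‖y‖ with h | h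
    · exact main y z hy hz hyz h
    · obtain ⟨m, h1, h2, h3, h4, h5⟩ := main z y hz hy (fun h => hyz h.symm) h
      rw [cd_symm C z y] at h3 h4 h5
      refine ⟨m, h1, by rwa [max_comm], h4, h3, fun x hx => ?_⟩
      have := h5 x hx
      linarith

/-! ### The discrete heat flow -/

def IsMid {Y : Type*} [PseudoMetricSpace Y] (δ : ℝ) (p q m : Y) : Prop :=
  dist p m ≤ dist p q / 2 ∧ dist q m ≤ dist p q / 2 ∧
    ∀ x, dist x p < δ → dist x q < δ →
      dist x m ^ 2 ≤ 1/2 * dist x p ^ 2 + 1/2 * dist x q ^ 2 - 1/4 * dist p q ^ 2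

lemma IsMid.symm {Y : Type*} [PseudoMetricSpace Y] {δ : ℝ} {p q m : Y} (h : IsMid δ p q m) :
    IsMid δ q p m := by
  obtain ⟨h1, h2, h3⟩ := h
  refine ⟨by rwa [dist_comm q p], by rwa [dist_comm q p], fun x hq hp => ?_⟩
  have := h3 x hp hq
  rw [dist_comm q p]; linarith

lemma isMid_self {Y : Type*} [PseudoMetricSpace Y] (δ : ℝ) (p : Y) : IsMid δ p p p := by
  refine ⟨by simp, by simp, fun x _ _ => ?_⟩
  simp; linarith

/-- a metric midpoint is a CN-midpoint -/
lemma isMid_of_dist {Y : Type*} [PseudoMetricSpace Y] {δ : ℝ} {p q m c : Y} (h : IsMid δ p q m)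
    (hpq : dist p q < δ) (h1 : dist p c = dist p q / 2) (h2 : dist q c = dist p q / 2) :
    IsMid δ p q c := by
  have hd : 0 ≤ dist p q := dist_nonneg
  have hc := h.2.2 c (by rw [dist_comm, h1]; linarith [hpq, hd])
    (by rw [dist_comm, h2]; linarith)
  rw [dist_comm c p, dist_comm c q, h1, h2] at hc
  have h0 : dist c m = 0 := by
    have : dist c m ^ 2 ≤ 0 := by nlinarith
    exact pow_eq_zero_iff (two_ne_zero) |>.1 (le_antisymm this (sq_nonneg _))
  have he : ∀ x, dist x c = dist x m := by
    intro x
    apply le_antisymm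
    · have := dist_triangle x m c
      rw [dist_comm m c, h0] at this; linarith
    · have := dist_triangle x c m
      linarith
  exact ⟨h1.le, h2.le, fun x hp hq => by rw [he]; exact h.2.2 x hp hq⟩

lemma mid_tri {Y : Type*} [PseudoMetricSpace Y] {δ : ℝ} {x y z m m' : Y}
    (h : IsMid δ x y m) (h' : IsMid δ x z m') (hxy : dist x y < δ / 2) (hxz : dist x z < δ / 2)
    (hyz : dist y z < δ / 2) : dist m m' ≤ dist y z / 2 := by
  have n1 : 0 ≤ dist x y := dist_nonneg
  have n2 : 0 ≤ dist x z := dist_nonneg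
  have n3 : 0 ≤ dist y z := dist_nonneg
  have e1 := h.1
  have e2 := h.2.1
  have a1 : dist m z ≤ dist y m + dist y z := by
    have := dist_triangle m y z; rwa [dist_comm m y] at this
  have b1 := h'.2.2 m (by rw [dist_comm]; linarith) (by linarith)
  have b2 := h.2.2 z (by rw [dist_comm]; linarith) (by rw [dist_comm]; linarith)
  rw [dist_comm z m, dist_comm z x, dist_comm z y] at b2
  have e3 : dist m x ^ 2 ≤ (dist x y / 2) ^ 2 := by
    rw [dist_comm]; exact pow_le_pow_left₀ dist_nonneg e1 2
  have : dist m m' ^ 2 ≤ (dist y z / 2) ^ 2 := by nlinarith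
  exact (abs_le_of_sq_le_sq' this (by linarith)).2

lemma mid_quad {Y : Type*} [PseudoMetricSpace Y] {δ : ℝ}
    (hCN : ∀ p q : Y, dist p q < δ → ∃ m, IsMid δ p q m) {p q p' q' m m' : Y}
    (h : IsMid δ p q m) (h' : IsMid δ p' q' m') (h1 : dist p q < δ / 2) (h2 : dist p' q' < δ / 2)
    (h3 : dist p p' < δ / 2) (h4 : dist q q' < δ / 2) (h5 : dist p q' < δ / 2) :
    dist m m' ≤ (dist p p' + dist q q') / 2 := by
  obtain ⟨c, hc⟩ := hCN p q' (by have : 0 ≤ dist p q' := dist_nonneg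
                                 linarith)
  have a := mid_tri h hc h1 h5 h4
  have b := mid_tri hc.symm h'.symm (by rwa [dist_comm]) (by rwa [dist_comm]) h3
  linarith [dist_triangle m c m']

structure Arr {Y : Type*} [PseudoMetricSpace Y] (N n : ℕ) (o : Y) (σ : ℕ → Y) (η : ℝ)
    (y : ℕ → ℕ → Y) : Prop where
  h0 : ∀ j ≤ N, y j 0 = o
  hn : ∀ j ≤ N, y j n = σ j
  hh : ∀ j ≤ N, ∀ i < n, dist (y j i) (y j (i+1)) ≤ η
  hv : ∀ j < N, ∀ i ≤ n, dist (y j i) (y (j+1) i) ≤ η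

def Len {Y : Type*} [PseudoMetricSpace Y] (n : ℕ) (z : ℕ → Y) : ℝ :=
  ∑ i ∈ Finset.range n, dist (z i) (z (i+1))

lemma arr_step {Y : Type*} [PseudoMetricSpace Y] {η : ℝ} (hη : 0 < η)
    (hCN : ∀ p q : Y, dist p q < 8 * η → ∃ m, IsMid (8 * η) p q m)
    {N n : ℕ} (hn : 0 < n) {o : Y} {σ : ℕ → Y}
    (hσ : ∀ j, j + 2 ≤ N → IsMid (8 * η) (σ j) (σ (j+2)) (σ (j+1)))
    {y : ℕ → ℕ → Y} (hy : Arr N n o σ η y) :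
    ∃ y', Arr N n o σ η y' ∧ y' 0 = y 0 ∧ y' N = y N ∧
      ∀ j, j + 2 ≤ N → Len n (y' (j+1)) ≤ (Len n (y j) + Len n (y (j+2))) / 2 := by
  have hv2 : ∀ j, j + 2 ≤ N → ∀ i ≤ n, dist (y j i) (y (j+2) i) ≤ 2 * η := by
    intro j hj i hi
    have := dist_triangle (y j i) (y (j+1) i) (y (j+2) i)
    have := hy.hv j (by omega) i hi
    have := hy.hv (j+1) (by omega) i hi
    linarith
  have ex : ∀ j i, ∃ m, (j + 2 ≤ N → i ≤ n → IsMid (8 * η) (y j i) (y (j+2) i) m) ∧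
      (i = 0 → j + 2 ≤ N → m = o) ∧ (i = n → j + 2 ≤ N → m = σ (j+1)) := by
    intro j i
    by_cases hj : j + 2 ≤ N
    · by_cases hi : i = 0
      · refine ⟨o, fun _ _ => ?_, fun _ _ => rfl, fun h => by omega⟩
        rw [hi, hy.h0 j (by omega), hy.h0 (j+2) hj]
        exact isMid_self _ _
      · by_cases hi' : i = n
        · refine ⟨σ (j+1), fun _ _ => ?_, fun h => by omega, fun _ _ => rfl⟩
          rw [hi', hy.hn j (by omega), hy.hn (j+2) hj]
          exact hσ j hj
        · by_cases hin : i ≤ n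
          · obtain ⟨m, hm⟩ := hCN (y j i) (y (j+2) i) (by linarith [hv2 j hj i hin])
            exact ⟨m, fun _ _ => hm, fun h => by omega, fun h => by omega⟩
          · exact ⟨o, fun _ h => by omega, fun h => by omega, fun h => by omega⟩
    · exact ⟨o, fun h => by omega, fun _ h => by omega, fun _ h => by omega⟩
  choose f hf1 hf2 hf3 using ex
  have horiz : ∀ j, j + 2 ≤ N → ∀ i < n, dist (f j i) (f j (i+1)) ≤
      (dist (y j i) (y j (i+1)) + dist (y (j+2) i) (y (j+2) (i+1))) / 2 := by
    intro j hj i hi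
    have a1 := hv2 j hj i hi.le
    have a2 := hv2 j hj (i+1) hi
    have a3 := hy.hh j (by omega) i hi
    have a4 := hy.hh (j+2) (by omega) i hi
    have a5 := dist_triangle (y j i) (y j (i+1)) (y (j+2) (i+1))
    exact mid_quad hCN (hf1 j i hj hi.le) (hf1 j (i+1) hj hi) (by linarith) (by linarith)
      (by linarith) (by linarith) (by linarith)
  have vert : ∀ j, j + 3 ≤ N → ∀ i ≤ n, dist (f j i) (f (j+1) i) ≤ η := by
    intro j hj i hi
    have a1 := hv2 j (by omega) i hi
    have a2 := hv2 (j+1) (by omega) i hi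
    have a3 := hy.hv j (by omega) i hi
    have a4 := hy.hv (j+2) (by omega) i hi
    have a5 := dist_triangle (y j i) (y (j+2) i) (y (j+3) i)
    have := mid_quad hCN (hf1 j i (by omega) hi) (hf1 (j+1) i (by omega) hi) (by linarith)
      (by linarith) (by linarith) (by linarith) (by linarith)
    have e : y (j+1+2) i = y (j+2+1) i := rfl
    rw [e] at this
    linarith
  refine ⟨fun j => if j = 0 ∨ N ≤ j then y j else f (j-1), ⟨?_, ?_, ?_, ?_⟩, ?_, ?_, ?_⟩
  · intro j hj
    split_ifs with h
    · exact hy.h0 j hj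
    · exact hf2 _ _ rfl (by omega)
  · intro j hj
    split_ifs with h
    · exact hy.hn j hj
    · rw [hf3 (j-1) n rfl (by omega)]
      congr 1; omega
  · intro j hj i hi
    split_ifs with h
    · exact hy.hh j hj i hi
    · have := horiz (j-1) (by omega) i hi
      have := hy.hh (j-1) (by omega) i hi
      have := hy.hh (j-1+2) (by omega) i hi
      linarith
  · intro j hj i hi
    have hj' : ¬ (j + 1 = 0) := by omega
    rcases Nat.eq_zero_or_pos j with h0 | h0
    · subst h0
      by_cases hN : N ≤ 1
      · simp only [hN, or_true, zero_add, if_true, true_or]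
        exact hy.hv 0 hj i hi
      · simp only [hN, zero_add, true_or, if_true]
        have := (hf1 0 i (by omega) hi).1
        have := hv2 0 (by omega) i hi
        simp at *
        linarith
    · by_cases hN : N ≤ j + 1
      · have e1 : ¬ (j = 0 ∨ N ≤ j) := by omega
        rw [if_neg e1, if_pos (Or.inr hN)]
        have h1 := (hf1 (j-1) i (by omega) hi).2.1
        have h2 := hv2 (j-1) (by omega) i hi
        have e : j - 1 + 2 = j + 1 := by omega
        rw [e] at h1 h2
        rw [dist_comm]; linarith
      · have e1 : ¬ (j = 0 ∨ N ≤ j) := by omega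
        have e2 : ¬ (j + 1 = 0 ∨ N ≤ j + 1) := by omega
        rw [if_neg e1, if_neg e2]
        have := vert (j-1) (by omega) i hi
        have e : j - 1 + 1 = j + 1 - 1 := by omega
        rwa [e] at this
  · simp
  · simp
  · intro j hj
    have e : ¬ (j + 1 = 0 ∨ N ≤ j + 1) := by omega
    simp only [if_neg e, Nat.add_sub_cancel]
    unfold Len
    rw [← Finset.sum_add_distrib, Finset.sum_div]
    apply Finset.sum_le_sum
    intro i hi
    exact horiz j hj i (Finset.mem_range.1 hi)

lemma flow {Y : Type*} [PseudoMetricSpace Y] {η : ℝ} (hη : 0 < η)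
    (hCN : ∀ p q : Y, dist p q < 8 * η → ∃ m, IsMid (8 * η) p q m)
    {N n : ℕ} (hN : 0 < N) (hn : 0 < n) {o : Y} {σ : ℕ → Y}
    (hσ : ∀ j, j + 2 ≤ N → IsMid (8 * η) (σ j) (σ (j+2)) (σ (j+1)))
    {y : ℕ → ℕ → Y} (hy : Arr N n o σ η y) (ε : ℝ) (hε : 0 < ε) (j : ℕ) (hj : j ≤ N) :
    ∃ z : ℕ → Y, z 0 = o ∧ z n = σ j ∧ (∀ i < n, dist (z i) (z (i+1)) ≤ η) ∧
      Len n z ≤ Len n (y 0) + (j / N : ℝ) * (Len n (y N) - Len n (y 0)) + ε := by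
  set A := Len n (y 0) with hA
  set B := Len n (y N) with hB
  have Lnn : ∀ z : ℕ → Y, 0 ≤ Len n z := fun z => Finset.sum_nonneg (fun _ _ => dist_nonneg)
  have hN' : (0:ℝ) < N := by exact_mod_cast hN
  set M : ℝ := ∑ j ∈ Finset.range (N+1), Len n (y j) with hM
  have hM0 : 0 ≤ M := Finset.sum_nonneg (fun j _ => Lnn _)
  set l : ℝ := 1 - 1 / (N:ℝ)^2 with hl
  have hN1 : (1:ℝ) ≤ N := by exact_mod_cast hN
  have hl0 : 0 ≤ l := by
    rw [hl, sub_nonneg, div_le_one (by positivity)]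
    nlinarith
  have hl1 : l < 1 := by
    rw [hl]; have : 0 < 1 / (N:ℝ)^2 := by positivity
    linarith
  have main : ∀ k : ℕ, ∃ y', Arr N n o σ η y' ∧ y' 0 = y 0 ∧ y' N = y N ∧
      ∀ j ≤ N, Len n (y' j) ≤ A + (j / N : ℝ) * (B - A) + M * l ^ k * ((j:ℝ) * (N - j)) := by
    intro k
    induction k with
    | zero =>
      refine ⟨y, hy, rfl, rfl, ?_⟩
      intro j hj
      rcases Nat.eq_zero_or_pos j with h0 | h0
      · subst h0; simp [hA]
      rcases hj.eq_or_lt with h1 | h1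
      · subst h1; simp [hB, div_self hN'.ne']
      have h2 : Len n (y j) ≤ M := by
        rw [hM]
        exact Finset.single_le_sum (f := fun j => Len n (y j)) (fun j _ => Lnn _)
          (Finset.mem_range.2 (by omega))
      have hj0 : (1:ℝ) ≤ j := by exact_mod_cast h0
      have hj1 : (1:ℝ) ≤ N - j := by
        have : (j:ℝ) + 1 ≤ N := by exact_mod_cast h1
        linarith
      have h3 : (1:ℝ) ≤ (j:ℝ) * (N - j) := by nlinarith
      have h4 : 0 ≤ A + (j / N : ℝ) * (B - A) := by
        have e : A + (j / N : ℝ) * (B - A) = (A * (N - j) + B * j) / N := by field_simp; ring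
        rw [e]
        have := Lnn (y 0)
        have := Lnn (y N)
        apply div_nonneg _ hN'.le
        apply add_nonneg <;> apply mul_nonneg <;> linarith
      have h5 : M * 1 ≤ M * ((j:ℝ) * (N - j)) := mul_le_mul_of_nonneg_left h3 hM0
      simp only [pow_zero, mul_one]
      linarith
    | succ k ih =>
      obtain ⟨y1, a1, a2, a3, a4⟩ := ih
      obtain ⟨y2, b1, b2, b3, b4⟩ := arr_step hη hCN hn hσ a1
      refine ⟨y2, b1, b2.trans a2, b3.trans a3, ?_⟩
      intro j hj
      rcases Nat.eq_zero_or_pos j with h0 | h0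
      · subst h0; rw [b2, a2]; simp [hA]
      rcases hj.eq_or_lt with h1 | h1
      · subst h1; rw [b3, a3]; simp [hB, div_self hN'.ne']
      obtain ⟨i, rfl⟩ : ∃ i, j = i + 1 := ⟨j - 1, by omega⟩
      have c := b4 i (by omega)
      have c1 := a4 i (by omega)
      have c2 := a4 (i+2) (by omega)
      have key : ((i:ℝ) * (N - i) + ((i + 2 : ℕ) : ℝ) * (N - ((i+2 : ℕ):ℝ))) / 2
          ≤ l * (((i+1:ℕ):ℝ) * (N - ((i+1 : ℕ):ℝ))) := by
        have : (((i+1:ℕ):ℝ) * (N - ((i+1 : ℕ):ℝ))) ≤ (N:ℝ)^2 := by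
          have : (0:ℝ) ≤ ((i+1:ℕ):ℝ) := by positivity
          have : ((i+1:ℕ):ℝ) ≤ N := by exact_mod_cast h1.le
          nlinarith
        have h6 : 1 / (N:ℝ)^2 * (((i+1:ℕ):ℝ) * (N - ((i+1 : ℕ):ℝ))) ≤ 1 := by
          rw [one_div, inv_mul_le_iff₀ (by positivity)]; linarith
        rw [hl, sub_mul, one_mul]
        push_cast at *
        nlinarith
      have hMl : 0 ≤ M * l ^ k := by positivity
      have := mul_le_mul_of_nonneg_left key hMl
      have e1 : ((i + 1 : ℕ) / N : ℝ) * (B - A)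
         = ((i / N : ℝ) * (B - A) + ((i + 2 : ℕ) / N : ℝ) * (B - A)) / 2 := by
        push_cast; ring
      rw [e1, pow_succ]
      nlinarith
  have lim : Filter.Tendsto (fun k : ℕ => M * l ^ k * ((j:ℝ) * (N - j))) Filter.atTop
      (nhds (M * 0 * ((j:ℝ) * (N - j)))) :=
    ((tendsto_pow_atTop_nhds_zero_of_lt_one hl0 hl1).const_mul M).mul_const _
  rw [mul_zero, zero_mul] at lim
  obtain ⟨k, hk⟩ := (lim.eventually (gt_mem_nhds hε)).exists
  obtain ⟨y1, a1, a2, a3, a4⟩ := main k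
  refine ⟨y1 j, a1.h0 j hj, a1.hn j hj, a1.hh j hj, ?_⟩
  have := a4 j hj
  linarith

/-! ### Local cone structure -/

def HPoly (S : Set E2) : Prop :=
  ∃ F : Set (E2 →ᵃ[ℝ] ℝ), F.Finite ∧ S = {x | ∀ f ∈ F, 0 ≤ f x}

lemma hpoly_simplex (t : Set E2) (ht : t.Finite) (hi : AffineIndependent ℝ ((↑) : t → E2)) :
    HPoly (convexHull ℝ t) := by
  obtain ⟨s, hts, hs, hspan⟩ := exists_subset_affineIndependent_affineSpan_eq_top hi
  have hsf : s.Finite := finite_set_of_fin_dim_affineIndependent ℝ hs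
  have : Fintype s := hsf.fintype
  let b : AffineBasis s ℝ E2 := ⟨(↑), hs, by simpa using hspan⟩
  have hb : ∀ i : s, b i = (i : E2) := fun i => rfl
  refine ⟨Set.range (fun i => b.coord i) ∪ (fun i => - b.coord i) '' {i : s | (i : E2) ∉ t}, ?_, ?_⟩
  · exact (Set.finite_range _).union (Set.toFinite _)
  · have key : convexHull ℝ t = {x | (∀ i, 0 ≤ b.coord i x) ∧ ∀ i : s, (i : E2) ∉ t → b.coord i x = 0} := by
      apply Set.Subset.antisymm
      · apply convexHull_min
        · intro x hx
          have hx' : b ⟨x, hts hx⟩ = x := rfl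
          constructor
          · intro i
            conv => rhs; rw [← hx']
            rw [b.coord_apply]; split_ifs <;> norm_num
          · intro i hi
            conv => lhs; rw [← hx']
            rw [b.coord_apply, if_neg]
            rintro rfl; exact hi hx
        · intro x hx y hy a c ha hc hac
          have h : ∀ i, b.coord i (a • x + c • y) = a * b.coord i x + c * b.coord i y := by
            intro i
            have := Convex.combo_affine_apply (f := b.coord i) (x := x) (y := y) hac
            simpa using this
          refine ⟨fun i => ?_, fun i hi => ?_⟩
          · rw [h]; have := hx.1 i; have := hy.1 i; positivity
          · rw [h, hx.2 i hi, hy.2 i hi]; simp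
      · rintro x ⟨h1, h2⟩
        have e := b.linear_combination_coord_eq_self x
        have e1 := b.sum_coord_apply_eq_one x
        rw [← e]
        classical
        have hz : ∀ i ∈ (Finset.univ : Finset s), i ∉ Finset.univ.filter (fun i : s => (i:E2) ∈ t) →
            b.coord i x = 0 := by
          intro i _ hi; apply h2; simpa using hi
        rw [← Finset.sum_subset (Finset.subset_univ (Finset.univ.filter (fun i : s => (i:E2) ∈ t)))
          (fun i a c => by rw [hz i a c, zero_smul])]
        apply (convex_convexHull ℝ t).sum_mem
        · intro i _; exact h1 i
        · rw [← e1]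
          exact Finset.sum_subset (Finset.subset_univ _) hz
        · intro i hi
          exact subset_convexHull ℝ t (show (i : E2) ∈ t by simpa using hi)
    rw [key]
    ext x
    simp only [Set.mem_ofPred_eq]
    constructor
    · rintro ⟨h1, h2⟩ f (⟨i, rfl⟩ | ⟨i, hi, rfl⟩)
      · exact h1 i
      · have := h2 i hi
        simp [this]
    · intro h
      have h1 : ∀ i, 0 ≤ b.coord i x := fun i => h _ (Or.inl ⟨i, rfl⟩)
      refine ⟨h1, fun i hi => ?_⟩
      have := h _ (Or.inr ⟨i, hi, rfl⟩)
      have h3 : 0 ≤ - b.coord i x := by simpa using this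
      linarith [h1 i]

def CCone (K : Set E2) : Prop :=
  IsClosed K ∧ ∀ x ∈ K, ∀ y ∈ K, ∀ a b : ℝ, 0 ≤ a → 0 ≤ b → a • x + b • y ∈ K

open Topology in
lemma hpoly_local {S : Set E2} (hS : HPoly S) (v : E2) :
    ∃ K, CCone K ∧ ∀ᶠ z in 𝓝 (0 : E2), (v + z ∈ S ↔ z ∈ K) := by
  obtain ⟨F, hF, rfl⟩ := hS
  have hcont : ∀ f : E2 →ᵃ[ℝ] ℝ, Continuous f := fun f => f.continuous_of_finiteDimensional
  by_cases hv : v ∈ {x | ∀ f ∈ F, 0 ≤ f x}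
  · refine ⟨{z | ∀ f ∈ F, f v = 0 → 0 ≤ f.linear z}, ⟨?_, ?_⟩, ?_⟩
    · simp only [Set.ofPred_forall]
      refine isClosed_biInter fun f _ => isClosed_iInter fun _ => ?_
      exact isClosed_le continuous_const (LinearMap.continuous_of_finiteDimensional f.linear)
    · intro x hx y hy a b ha hb f hf h0
      have h1 := hx f hf h0
      have h2 := hy f hf h0
      rw [map_add, map_smul, map_smul]; simp only [smul_eq_mul]; positivity
    · have hd : ∀ (f : E2 →ᵃ[ℝ] ℝ) (z : E2), f (v + z) = f.linear z + f v := by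
        intro f z
        have := f.map_vadd v z
        rw [add_comm v z]; simpa using this
      have : ∀ᶠ z in 𝓝 (0 : E2), ∀ f ∈ F, f v ≠ 0 → 0 < f (v + z) := by
        rw [Filter.eventually_all_finite hF]
        intro f hf
        by_cases h0 : f v = 0
        · simp [h0]
        · have hp : 0 < f v := lt_of_le_of_ne (hv f hf) (Ne.symm h0)
          have hc : ContinuousAt (fun z => f (v + z)) 0 :=
            ((hcont f).comp (continuous_const.add continuous_id)).continuousAt
          have h3 : 0 < f (v + 0) := by simpa using hp
          filter_upwards [hc.eventually (lt_mem_nhds h3)] with z hz _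
          exact hz
      filter_upwards [this] with z hz
      constructor
      · intro h f hf h0
        have := h f hf; rw [hd, h0, add_zero] at this; exact this
      · intro h f hf
        by_cases h0 : f v = 0
        · rw [hd, h0, add_zero]; exact h f hf h0
        · exact (hz f hf h0).le
  · refine ⟨∅, ⟨isClosed_empty, by simp⟩, ?_⟩
    have hcl : IsClosed {x : E2 | ∀ f ∈ F, 0 ≤ f x} := by
      simp only [Set.ofPred_forall]
      exact isClosed_biInter fun f _ => isClosed_le continuous_const (hcont f)
    have h1 : ∀ᶠ x in 𝓝 v, x ∉ {x : E2 | ∀ f ∈ F, 0 ≤ f x} := hcl.isOpen_compl.mem_nhds hv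
    have h2 : Filter.Tendsto (fun z => v + z) (𝓝 (0:E2)) (𝓝 v) := by
      have : Continuous (fun z : E2 => v + z) := by fun_prop
      simpa using this.tendsto 0
    filter_upwards [h2.eventually h1] with z hz
    simpa using hz

structure LocCone (X : Set E2) (v : E2) (r : ℝ) (C : Set E2) : Prop where
  pos : 0 < r
  cn : IsCn C
  mem : ∀ z, ‖z‖ < r → (v + z ∈ X ↔ z ∈ C)
  vis : ∀ p ∈ C, p ≠ 0 → ∃ ρ > 0, ∀ x ∈ C, ∀ y ∈ C, ‖x - p‖ < ρ → ‖y - p‖ < ρ → Vis C x y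

open Topology in
lemma locCone_of_cones (X : Set E2) (v : E2) (𝒦 : Set (Set E2)) (hf : 𝒦.Finite)
    (hK : ∀ K ∈ 𝒦, CCone K) (h : ∀ᶠ z in 𝓝 (0 : E2), (v + z ∈ X ↔ z ∈ ⋃₀ 𝒦)) :
    ∃ r, LocCone X v r (⋃₀ 𝒦) := by
  obtain ⟨r, hr, hr'⟩ := Metric.eventually_nhds_iff.1 h
  have hcn : IsCn (⋃₀ 𝒦) := by
    rintro x ⟨K, hKm, hx⟩ s hs
    refine ⟨K, hKm, ?_⟩
    have := (hK K hKm).2 x hx x hx s 0 hs le_rfl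
    simpa using this
  refine ⟨r, hr, hcn, fun z hz => hr' (by simpa using hz), ?_⟩
  intro p hp hp0
  have h1 : ∀ᶠ x in 𝓝 p, ∀ K ∈ 𝒦, x ∈ K → p ∈ K := by
    rw [Filter.eventually_all_finite hf]
    intro K hKm
    by_cases hpK : p ∈ K
    · simp [hpK]
    · filter_upwards [(hK K hKm).1.isOpen_compl.mem_nhds hpK] with x hx hx'
      exact absurd hx' hx
  have h2 : ∀ᶠ x in 𝓝 p, 0 < inner ℝ x p := by
    have hc : Continuous (fun x : E2 => inner ℝ x p) := by fun_prop
    have : 0 < inner ℝ p p := by rw [real_inner_self_eq_norm_sq]; positivity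
    exact hc.continuousAt.eventually (lt_mem_nhds this)
  obtain ⟨ρ, hρ, hh⟩ := Metric.eventually_nhds_iff.1 (h1.and h2)
  refine ⟨ρ, hρ, fun x hx y hy hxp hyp => ?_⟩
  have hv : ∀ x ∈ ⋃₀ 𝒦, ‖x - p‖ < ρ → Vis (⋃₀ 𝒦) p x := by
    rintro x ⟨K, hKm, hx⟩ hxp a b ha hb
    refine ⟨K, hKm, (hK K hKm).2 _ ((hh (by rwa [dist_eq_norm])).1 K hKm hx) _ hx a b ha hb⟩
  by_contra hn
  have := key_cone' hcn hx hy (hv x hx hxp) (hv y hy hyp) hn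
  have i1 := (hh (y := x) (by rwa [dist_eq_norm])).2
  have i2 := (hh (y := y) (by rwa [dist_eq_norm])).2
  have n1 : 0 < ‖x‖ := norm_pos_iff.2 (by rintro rfl; simp at i1)
  have n2 : 0 < ‖y‖ := norm_pos_iff.2 (by rintro rfl; simp at i2)
  have : 0 < inner ℝ x p / ‖x‖ + inner ℝ y p / ‖y‖ := by positivity
  linarith

open Topology in
lemma exists_locCone {X : Set E2}
    (hpoly : ∃ (n : ℕ) (P : Fin n → Finset E2), X = ⋃ i, convexHull ℝ (↑(P i) : Set E2)) (v : E2) :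
    ∃ r C, LocCone X v r C := by
  obtain ⟨n, P, rfl⟩ := hpoly
  have h𝒮 : ∃ 𝒮 : Set (Set E2), 𝒮.Finite ∧ (∀ S ∈ 𝒮, HPoly S) ∧
      (⋃ i, convexHull ℝ (↑(P i) : Set E2)) = ⋃₀ 𝒮 := by
    refine ⟨⋃ i, {S | ∃ t : Set E2, t ⊆ P i ∧ AffineIndependent ℝ ((↑) : t → E2) ∧
      S = convexHull ℝ t}, ?_, ?_, ?_⟩
    · refine Set.finite_iUnion fun i => ?_
      refine ((Set.Finite.finite_subsets (P i).finite_toSet).image (fun t => convexHull ℝ t)).subset ?_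
      rintro S ⟨t, ht, -, rfl⟩
      exact ⟨t, ht, rfl⟩
    · intro S hS
      obtain ⟨i, t, ht, hi, rfl⟩ := Set.mem_iUnion.1 hS
      exact hpoly_simplex t ((P i).finite_toSet.subset ht) hi
    · ext x
      simp only [Set.mem_iUnion, Set.mem_sUnion]
      constructor
      · rintro ⟨i, hx⟩
        rw [convexHull_eq_union] at hx
        simp only [Set.mem_iUnion] at hx
        obtain ⟨t, ht, hi, hx⟩ := hx
        exact ⟨_, ⟨i, t, ht, hi, rfl⟩, hx⟩
      · rintro ⟨S, ⟨i, t, ht, hi, rfl⟩, hx⟩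
        exact ⟨i, convexHull_mono ht hx⟩
  obtain ⟨𝒮, hfin, hH, hX⟩ := h𝒮
  rw [hX]
  choose! K hK hKe using fun S (hS : S ∈ 𝒮) => hpoly_local (hH S hS) v
  have : ∀ᶠ z in 𝓝 (0 : E2), ∀ S ∈ 𝒮, (v + z ∈ S ↔ z ∈ K S) :=
    (Filter.eventually_all_finite hfin).2 hKe
  obtain ⟨r, hr⟩ := locCone_of_cones (⋃₀ 𝒮) v (K '' 𝒮) (hfin.image K)
    (by rintro _ ⟨S, hS, rfl⟩; exact hK S hS) (by
      filter_upwards [this] with z hz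
      simp only [Set.mem_sUnion, Set.exists_mem_image]
      constructor
      · rintro ⟨S, hS, h⟩; exact ⟨S, hS, (hz S hS).1 h⟩
      · rintro ⟨S, hS, h⟩; exact ⟨S, hS, (hz S hS).2 h⟩)
  exact ⟨r, _, hr⟩

/-! ### Costs -/

section costs
variable {X : Set E2}

lemma cost_of_affine {a b c d : X} (σ : Path a b) (γ : Path c d) {t₁ t₂ : unitInterval}
    (h : t₁ ≤ t₂)
    (he : ∀ s : unitInterval, σ s = γ ⟨(1 - s.1) * t₁.1 + s.1 * t₂.1, subIcc_mem s t₁ t₂⟩) :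
    cost σ = eVariationOn (fun t => (γ t : E2)) (Set.Icc t₁ t₂) := by
  set φ : unitInterval → unitInterval :=
    fun s => ⟨(1 - s.1) * t₁.1 + s.1 * t₂.1, subIcc_mem s t₁ t₂⟩ with hφ
  have h' : t₁.1 ≤ t₂.1 := h
  have hm : Monotone φ := by
    intro s s' hs
    have hs' : s.1 ≤ s'.1 := hs
    change (1 - s.1) * t₁.1 + s.1 * t₂.1 ≤ (1 - s'.1) * t₁.1 + s'.1 * t₂.1
    nlinarith
  have him : φ '' Set.univ = Set.Icc t₁ t₂ := by
    apply Set.Subset.antisymm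
    · rintro _ ⟨s, -, rfl⟩
      have := s.2.1
      have := s.2.2
      constructor
      · change t₁.1 ≤ (1 - s.1) * t₁.1 + s.1 * t₂.1
        nlinarith
      · change (1 - s.1) * t₁.1 + s.1 * t₂.1 ≤ t₂.1
        nlinarith
    · intro u hu
      have hu1 : t₁.1 ≤ u.1 := hu.1
      have hu2 : u.1 ≤ t₂.1 := hu.2
      rcases h'.eq_or_lt with e | e
      · refine ⟨0, trivial, Subtype.ext ?_⟩
        change (1 - (0:ℝ)) * t₁.1 + 0 * t₂.1 = u.1
        linarith
      · refine ⟨⟨(u.1 - t₁.1) / (t₂.1 - t₁.1), ?_, ?_⟩, trivial, Subtype.ext ?_⟩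
        · apply div_nonneg <;> linarith
        · rw [div_le_one (by linarith)]; linarith
        · change (1 - (u.1 - t₁.1) / (t₂.1 - t₁.1)) * t₁.1 +
            (u.1 - t₁.1) / (t₂.1 - t₁.1) * t₂.1 = u.1
          have : t₂.1 - t₁.1 ≠ 0 := by linarith
          field_simp
          ring
  have e := eVariationOn.comp_eq_of_monotoneOn (fun t => (γ t : E2)) φ (hm.monotoneOn Set.univ)
  rw [him] at e
  rw [← e]
  unfold cost
  congr 1
  funext s
  simp only [Function.comp, he s, hφ]

lemma cost_subpath {a b : X} (γ : Path a b) {t₁ t₂ : unitInterval} (h : t₁ ≤ t₂) :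
    cost (subpath γ t₁ t₂) = eVariationOn (fun t => (γ t : E2)) (Set.Icc t₁ t₂) :=
  cost_of_affine _ γ h (fun _ => rfl)

lemma cost_eq_Icc {a b : X} (γ : Path a b) :
    cost γ = eVariationOn (fun t => (γ t : E2)) (Set.Icc 0 1) := by
  unfold cost
  congr 1
  ext t
  simp [unitInterval.le_one', unitInterval.nonneg']

lemma evar_add {a b : X} (γ : Path a b) {r s t : unitInterval} (h : r ≤ s) (h' : s ≤ t) :
    eVariationOn (fun t => (γ t : E2)) (Set.Icc r s) +
      eVariationOn (fun t => (γ t : E2)) (Set.Icc s t) =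
      eVariationOn (fun t => (γ t : E2)) (Set.Icc r t) := by
  have := eVariationOn.Icc_add_Icc (fun t => (γ t : E2)) h h' (Set.mem_univ s)
  simpa using this

lemma cost_split {a b : X} (γ : Path a b) (t : unitInterval) :
    cost γ = eVariationOn (fun t => (γ t : E2)) (Set.Icc 0 t) +
      eVariationOn (fun t => (γ t : E2)) (Set.Icc t 1) := by
  rw [evar_add γ unitInterval.nonneg' unitInterval.le_one', cost_eq_Icc]

lemma cost_cast {a b a' b' : X} (γ : Path a b) (ha : a' = a) (hb : b' = b) :
    cost (γ.cast ha hb) = cost γ := rfl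

lemma cost_trans {a b c : X} (σ : Path a b) (τ : Path b c) :
    cost (σ.trans τ) = cost σ + cost τ := by
  set hf : unitInterval := ⟨1/2, by norm_num, by norm_num⟩ with hhf
  rw [cost_split (σ.trans τ) hf]
  congr 1
  · symm
    apply cost_of_affine _ _ unitInterval.nonneg'
    intro s
    rw [Path.trans_apply, dif_pos]
    · congr 1
      apply Subtype.ext
      simp [hhf]
      ring
    · have := s.2.2
      simp [hhf]
      linarith
  · symm
    apply cost_of_affine _ _ unitInterval.le_one'
    intro s
    rw [Path.trans_apply]
    have h0 := s.2.1
    split_ifs with h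
    · have hs : s.1 = 0 := by
        simp [hhf] at h
        linarith
      have hs' : s = 0 := Subtype.ext hs
      subst hs'
      simp [hhf]
    · congr 1
      apply Subtype.ext
      simp [hhf]
      ring

lemma cost_symm {a b : X} (σ : Path a b) : cost σ.symm = cost σ := by
  have e := eVariationOn.comp_eq_of_antitoneOn (fun t => (σ t : E2)) unitInterval.symm
    (t := Set.univ) (fun s _ t _ h => by simpa using h)
  have : unitInterval.symm '' Set.univ = Set.univ := by
    rw [Set.image_univ]; exact unitInterval.symm_bijective.surjective.range_eq
  rw [this] at e
  exact e

lemma edist_le_evar {a b : X} (σ : Path a b) {s t : unitInterval} (h : s ≤ t) :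
    ENNReal.ofReal ‖(σ s : E2) - σ t‖ ≤ eVariationOn (fun t => (σ t : E2)) (Set.Icc s t) := by
  have := eVariationOn.edist_le (fun t => (σ t : E2)) (Set.left_mem_Icc.2 h) (Set.right_mem_Icc.2 h)
  rwa [edist_dist, dist_eq_norm] at this

lemma norm_le_cost {a b : X} (σ : Path a b) (t : unitInterval) :
    ENNReal.ofReal ‖(a : E2) - σ t‖ ≤ cost σ := by
  have := edist_le_evar σ (unitInterval.nonneg' : 0 ≤ t)
  rw [σ.source] at this
  rw [cost_split σ t]
  exact this.trans le_self_add

lemma norm_le_cost' {a b : X} (σ : Path a b) :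
    ENNReal.ofReal ‖(a : E2) - b‖ ≤ cost σ := by
  have := norm_le_cost σ 1
  rwa [σ.target] at this

lemma cost_refl (a : X) : cost (Path.refl a) = 0 := by
  apply eVariationOn.constant_on
  intro x hx y hy
  obtain ⟨s, -, rfl⟩ := hx
  obtain ⟨t, -, rfl⟩ := hy
  rfl

lemma cost_linePath {x₀ x₁ : E2} (h₀ : x₀ ∈ X) (h₁ : x₁ ∈ X)
    (hseg : segment ℝ x₀ x₁ ⊆ X) : cost (linePath h₀ h₁ hseg) ≤ ENNReal.ofReal ‖x₀ - x₁‖ := by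
  have hL : LipschitzWith ‖x₀ - x₁‖₊ (fun s : ℝ => (1 - s) • x₀ + s • x₁) := by
    apply LipschitzWith.of_dist_le_mul
    intro s t
    rw [dist_eq_norm, dist_eq_norm]
    have : (1 - s) • x₀ + s • x₁ - ((1 - t) • x₀ + t • x₁) = (t - s) • (x₀ - x₁) := by module
    rw [this, norm_smul, norm_sub_rev t s, mul_comm]
    rfl
  have h1 := (hL.lipschitzOnWith (s := Set.univ)).comp_eVariationOn_le
    (g := fun t : unitInterval => (t : ℝ)) (s := Set.univ) (Set.mapsTo_univ _ _)
  have h2 : eVariationOn (fun t : unitInterval => (t : ℝ)) Set.univ ≤ ENNReal.ofReal (1 - 0) := by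
    have := MonotoneOn.eVariationOn_le (f := fun t : unitInterval => (t : ℝ)) (s := Set.univ)
      (fun s _ t _ h => h) (Set.mem_univ 0) (Set.mem_univ 1)
    simp only [Set.univ_inter] at this
    have e : (Set.Icc (0 : unitInterval) 1) = Set.univ := by
      ext t
      simp [unitInterval.le_one', unitInterval.nonneg']
    rw [e] at this
    simpa using this
  calc cost (linePath h₀ h₁ hseg) ≤ ‖x₀ - x₁‖₊ * eVariationOn (fun t : unitInterval => (t : ℝ)) Set.univ := h1
    _ ≤ ‖x₀ - x₁‖₊ * ENNReal.ofReal (1 - 0) := by gcongr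
    _ = ENNReal.ofReal ‖x₀ - x₁‖ := by
      simp [ofReal_norm, enorm]

/-! ### Local paths -/

lemma LocCone.mono {v : E2} {r r' : ℝ} {C : Set E2} (h : LocCone X v r C) (h0 : 0 < r')
    (hr : r' ≤ r) : LocCone X v r' C :=
  ⟨h0, h.cn, fun z hz => h.mem z (hz.trans_le hr), h.vis⟩

lemma LocCone.mem' {v : E2} {r : ℝ} {C : Set E2} (h : LocCone X v r C) {x : E2}
    (hx : ‖x - v‖ < r) : x ∈ X ↔ x - v ∈ C := by
  have := h.mem (x - v) hx
  simpa using this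

lemma LocCone.smul_mem {v : E2} {r : ℝ} {C : Set E2} (h : LocCone X v r C) {x : E2}
    (hx : ‖x - v‖ < r) (hX : x ∈ X) {s : ℝ} (hs : 0 ≤ s) (hs1 : s ≤ 1) :
    v + s • (x - v) ∈ X ∧ ‖v + s • (x - v) - v‖ < r := by
  have e : v + s • (x - v) - v = s • (x - v) := by abel
  have h2 : ‖s • (x - v)‖ < r := by
    rw [norm_smul, Real.norm_of_nonneg hs]
    nlinarith [norm_nonneg (x - v)]
  rw [e]
  exact ⟨(h.mem _ h2).2 (h.cn _ ((h.mem' hx).1 hX) s hs), h2⟩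

lemma LocCone.star {v : E2} {r : ℝ} {C : Set E2} (h : LocCone X v r C) :
    StarConvex ℝ v (X ∩ Metric.ball v r) := by
  intro x hx a b ha hb hab
  have hx2 : ‖x - v‖ < r := by simpa [dist_eq_norm] using hx.2
  have := h.smul_mem hx2 hx.1 hb (by linarith)
  have e : a • v + b • x = v + b • (x - v) := by
    rw [show a = 1 - b by linarith]; module
  rw [e]
  exact ⟨this.1, by simpa [dist_eq_norm] using this.2⟩

/-- paths in a small ball are homotopic -/
lemma LocCone.homotopic {v : E2} {r : ℝ} {C : Set E2} (h : LocCone X v r C) {x y : X}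
    (p q : Path x y) (hp : ∀ t, ‖(p t : E2) - v‖ < r) (hq : ∀ t, ‖(q t : E2) - v‖ < r) :
    p.Homotopic q := by
  have hne : (X ∩ Metric.ball v r).Nonempty :=
    ⟨x, x.2, by have := hp 0; rw [p.source] at this; simpa [dist_eq_norm] using this⟩
  have hv : v ∈ X ∩ Metric.ball v r := h.star.mem hne
  have hcs : ContractibleSpace (X ∩ Metric.ball v r : Set E2) := h.star.contractibleSpace hne
  have hsc : SimplyConnectedSpace (X ∩ Metric.ball v r : Set E2) := inferInstance
  let ι : (X ∩ Metric.ball v r : Set E2) → X := fun u => ⟨u.1, u.2.1⟩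
  have hι : Continuous ι := by fun_prop
  have lift : ∀ p : Path x y, (∀ t, ‖(p t : E2) - v‖ < r) → ∀ hx hy,
      ∃ p' : Path (⟨x, hx⟩ : (X ∩ Metric.ball v r : Set E2)) ⟨y, hy⟩, ∀ t, ι (p' t) = p t := by
    intro p hp hx hy
    refine ⟨⟨⟨fun t => ⟨p t, (p t).2, by simpa [dist_eq_norm] using hp t⟩, ?_⟩, ?_, ?_⟩, ?_⟩
    · fun_prop
    · apply Subtype.ext; simp
    · apply Subtype.ext; simp
    · intro t; rfl
  have hx : (x : E2) ∈ X ∩ Metric.ball v r :=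
    ⟨x.2, by have := hp 0; rw [p.source] at this; simpa [dist_eq_norm] using this⟩
  have hy : (y : E2) ∈ X ∩ Metric.ball v r :=
    ⟨y.2, by have := hp 1; rw [p.target] at this; simpa [dist_eq_norm] using this⟩
  obtain ⟨p', hp'⟩ := lift p hp hx hy
  obtain ⟨q', hq'⟩ := lift q hq hx hy
  have := (SimplyConnectedSpace.paths_homotopic p' q').map ⟨ι, hι⟩
  have e1 : p'.map hι = p := by ext t; simp [hp']
  have e2 : q'.map hι = q := by ext t; simp [hq']
  have e3 : (p'.map hι).Homotopic (q'.map hι) := this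
  rwa [e1, e2] at e3

lemma LocCone.exists_path {v : E2} {r : ℝ} {C : Set E2} (h : LocCone X v r C) (x y : X)
    (hx : ‖(x : E2) - v‖ < r) (hy : ‖(y : E2) - v‖ < r) :
    ∃ γ : Path x y, (∀ t, ‖(γ t : E2) - v‖ < r) ∧
      cost γ ≤ ENNReal.ofReal (cd C (x - v) (y - v)) := by
  have hb : Convex ℝ (Metric.ball v r) := convex_ball v r
  have hv : v ∈ Metric.ball v r := Metric.mem_ball_self h.pos
  have hxC := (h.mem' hx).1 x.2
  have hyC := (h.mem' hy).1 y.2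
  have hvX : v ∈ X := by
    have := (h.smul_mem hx x.2 le_rfl zero_le_one).1
    simpa using this
  have hxb : (x : E2) ∈ Metric.ball v r := by simpa [dist_eq_norm] using hx
  have hyb : (y : E2) ∈ Metric.ball v r := by simpa [dist_eq_norm] using hy
  have key : ∀ (x y : X) (hx : (x : E2) ∈ Metric.ball v r) (hy : (y : E2) ∈ Metric.ball v r),
      Vis C (x - v) (y - v) → ∃ γ : Path x y, (∀ t, ‖(γ t : E2) - v‖ < r) ∧
        cost γ ≤ ENNReal.ofReal ‖(x : E2) - y‖ := by
    intro x y hx hy hvis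
    have hs : segment ℝ (x : E2) y ⊆ Metric.ball v r := hb.segment_subset hx hy
    have hseg : segment ℝ (x : E2) y ⊆ X := by
      intro w hw
      have hw' := hs hw
      obtain ⟨a, b, ha, hb, hab, rfl⟩ := hw
      rw [h.mem' (by simpa [dist_eq_norm] using hw')]
      have e : a • (x : E2) + b • (y : E2) - v = a • ((x : E2) - v) + b • ((y : E2) - v) := by
        rw [show a = 1 - b by linarith]; module
      rw [e]; exact hvis a b ha hb
    refine ⟨linePath x.2 y.2 hseg, fun t => ?_, cost_linePath _ _ _⟩
    have : ((linePath x.2 y.2 hseg t : X) : E2) ∈ segment ℝ (x : E2) y := by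
      rw [segment_eq_image]; exact ⟨t.1, t.2, rfl⟩
    simpa [dist_eq_norm] using hs this
  by_cases hvis : Vis C (x - v) (y - v)
  · obtain ⟨γ, h1, h2⟩ := key x y hxb hyb hvis
    refine ⟨γ, h1, ?_⟩
    rw [cd_of_vis hvis]
    simpa using h2
  · obtain ⟨γ, h1, h2⟩ := key x ⟨v, hvX⟩ hxb hv (by simpa using (vis_zero h.cn hxC).symm)
    obtain ⟨γ', h1', h2'⟩ := key ⟨v, hvX⟩ y hv hyb (by simpa using (vis_zero h.cn hyC))
    refine ⟨γ.trans γ', fun t => ?_, ?_⟩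
    · rw [Path.trans_apply]
      split_ifs
      · exact h1 _
      · exact h1' _
    · rw [cost_trans, cd_of_not hvis, ENNReal.ofReal_add (norm_nonneg _) (norm_nonneg _)]
      refine add_le_add h2 ?_
      rw [norm_sub_rev] at h2'
      exact h2'

lemma LocCone.cd_le_cost {v : E2} {r : ℝ} {C : Set E2} (h : LocCone X v r C) {x y : X}
    (γ : Path x y) (hγ : ∀ t, ‖(γ t : E2) - v‖ < r) :
    ENNReal.ofReal (cd C (x - v) (y - v)) ≤ cost γ := by
  have hC : ∀ t, (γ t : E2) - v ∈ C := fun t => (h.mem' (hγ t)).1 (γ t).2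
  by_cases hv : ∃ t, (γ t : E2) = v
  · obtain ⟨t, ht⟩ := hv
    have h1 := edist_le_evar γ (unitInterval.nonneg' : 0 ≤ t)
    have h2 := edist_le_evar γ (unitInterval.le_one' : t ≤ 1)
    rw [γ.source, ht] at h1
    rw [γ.target, ht, norm_sub_rev] at h2
    rw [cost_split γ t]
    calc ENNReal.ofReal (cd C (x - v) (y - v)) ≤ ENNReal.ofReal (‖(x : E2) - v‖ + ‖(y : E2) - v‖) :=
          ENNReal.ofReal_le_ofReal (cd_le _ _ _)
      _ = _ := ENNReal.ofReal_add (norm_nonneg _) (norm_nonneg _)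
      _ ≤ _ := add_le_add h1 h2
  · push Not at hv
    choose ρ hρ hvis using fun t => h.vis _ (hC t) (sub_ne_zero.2 (hv t))
    let c : unitInterval → Set unitInterval := fun t => {s | ‖((γ s : E2) - v) - ((γ t : E2) - v)‖ < ρ t}
    have hc : ∀ t, IsOpen (c t) := fun t => isOpen_lt (by fun_prop) continuous_const
    have hcov : Set.univ ⊆ ⋃ t, c t := fun t _ => Set.mem_iUnion.2 ⟨t, by
      simp only [c, Set.mem_ofPred_eq, sub_self, norm_zero]; exact hρ t⟩
    obtain ⟨t, ht0, hmono, ⟨n, hn⟩, hsub⟩ :=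
      exists_monotone_Icc_subset_open_cover_unitInterval hc hcov
    have ind : ∀ k, ENNReal.ofReal (cd C (x - v) (γ (t k) - v)) ≤
        eVariationOn (fun t => (γ t : E2)) (Set.Icc 0 (t k)) := by
      intro k
      induction k with
      | zero =>
        have := vis_self h.cn (hC 0)
        rw [γ.source] at this
        rw [ht0, γ.source, cd_of_vis this]; simp
      | succ k ih =>
        have hk : t k ≤ t (k+1) := hmono (Nat.le_succ k)
        rw [← evar_add γ (unitInterval.nonneg' : 0 ≤ t k) hk]
        have hxC := hC 0
        rw [γ.source] at hxC
        have tri := cd_triangle h.cn (y := γ (t k) - v) hxC (hC (t (k+1)))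
        obtain ⟨i, hi⟩ := hsub k
        have hvv := hvis i _ (hC (t k)) _ (hC (t (k+1))) (hi (Set.left_mem_Icc.2 hk))
          (hi (Set.right_mem_Icc.2 hk))
        rw [cd_of_vis hvv] at tri
        have h3 := edist_le_evar γ hk
        calc _ ≤ _ := ENNReal.ofReal_le_ofReal tri
          _ = _ := ENNReal.ofReal_add (cd_nonneg _ _ _) (norm_nonneg _)
          _ ≤ _ := add_le_add ih (by simpa using h3)
    have := ind n
    rw [hn n le_rfl, γ.target, ← cost_eq_Icc] at this
    exact this

/-- uniform version -/
lemma exists_lebesgue (hcomp : IsCompact X)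
    (hpoly : ∃ (n : ℕ) (P : Fin n → Finset E2), X = ⋃ i, convexHull ℝ (↑(P i) : Set E2))
    {κ : ℝ} (hκ : 0 < κ) : ∃ δ > 0, ∀ x ∈ X, ∃ v r C, LocCone X v r C ∧ r ≤ κ ∧
      ∀ y, ‖y - x‖ < δ → ‖y - v‖ < r := by
  have : ∀ v : E2, ∃ r C, LocCone X v r C ∧ r ≤ κ := by
    intro v
    obtain ⟨r, C, h⟩ := exists_locCone hpoly v
    exact ⟨min r κ, C, h.mono (lt_min h.pos hκ) (min_le_left _ _), min_le_right _ _⟩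
  choose r C h hr using this
  obtain ⟨δ, hδ, hl⟩ := lebesgue_number_lemma_of_metric (c := fun v : E2 => Metric.ball v (r v)) hcomp
    (fun v => Metric.isOpen_ball) (fun x _ => Set.mem_iUnion.2 ⟨x, Metric.mem_ball_self (h x).pos⟩)
  refine ⟨δ, hδ, fun x hx => ?_⟩
  obtain ⟨v, hv⟩ := hl x hx
  refine ⟨v, r v, C v, h v, hr v, fun y hy => ?_⟩
  have := hv (show y ∈ Metric.ball x δ by simpa [dist_eq_norm] using hy)
  simpa [dist_eq_norm] using this

end costs

/-! ### The space of homotopy classes -/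

def Cov {X : Set E2} (xa : X) : Type := Σ x : X, Path.Homotopic.Quotient xa x

section cov
variable {X : Set E2} {xa : X}

def Lk (p q : Cov xa) (γ : Path p.1 q.1) : Prop :=
  p.2.trans (Path.Homotopic.Quotient.mk γ) = q.2

lemma lk_refl (p : Cov xa) : Lk p p (Path.refl p.1) := by
  unfold Lk; rw [Path.Homotopic.Quotient.mk_refl, Path.Homotopic.Quotient.trans_refl]

lemma Lk.symm {p q : Cov xa} {γ : Path p.1 q.1} (h : Lk p q γ) : Lk q p γ.symm := by
  unfold Lk at *
  rw [← h, Path.Homotopic.Quotient.trans_assoc, Path.Homotopic.Quotient.mk_symm,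
    Path.Homotopic.Quotient.trans_symm, Path.Homotopic.Quotient.trans_refl]

lemma Lk.trans {p q w : Cov xa} {γ : Path p.1 q.1} {γ' : Path q.1 w.1} (h : Lk p q γ)
    (h' : Lk q w γ') : Lk p w (γ.trans γ') := by
  unfold Lk at *
  rw [Path.Homotopic.Quotient.mk_trans, ← Path.Homotopic.Quotient.trans_assoc, h, h']

lemma Lk.homotopic {p q : Cov xa} {γ γ' : Path p.1 q.1} (h : Lk p q γ) (hh : γ.Homotopic γ') :
    Lk p q γ' := by
  unfold Lk at *
  rw [← Path.Homotopic.Quotient.eq.2 hh, h]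

lemma Lk.unique {p q q' : Cov xa} {γ : Path p.1 q.1} {γ' : Path p.1 q'.1} (h : Lk p q γ)
    (h' : Lk p q' γ') (hq : q.1 = q'.1) (hh : γ.Homotopic (γ'.cast rfl hq)) : q = q' := by
  obtain ⟨q1, q2⟩ := q
  obtain ⟨q1', q2'⟩ := q'
  dsimp only at hq
  subst hq
  unfold Lk at *
  dsimp only at *
  have : Path.Homotopic.Quotient.mk γ = Path.Homotopic.Quotient.mk γ' :=
    Path.Homotopic.Quotient.eq.2 hh
  rw [← h, ← h', this]

def Dc (p q : Cov xa) : ENNReal := ⨅ γ : {γ : Path p.1 q.1 // Lk p q γ}, cost γ.1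

lemma Dc_le {p q : Cov xa} {γ : Path p.1 q.1} (h : Lk p q γ) : Dc p q ≤ cost γ :=
  iInf_le (fun γ : {γ : Path p.1 q.1 // Lk p q γ} => cost γ.1) ⟨γ, h⟩

lemma exists_of_Dc_lt {p q : Cov xa} {c : ENNReal} (h : Dc p q < c) :
    ∃ γ, Lk p q γ ∧ cost γ < c := by
  obtain ⟨γ, hγ⟩ := iInf_lt_iff.1 h
  exact ⟨γ.1, γ.2, hγ⟩

lemma Dc_self (p : Cov xa) : Dc p p = 0 :=
  le_antisymm ((Dc_le (lk_refl p)).trans (cost_refl _).le) bot_le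

lemma Dc_comm_le (p q : Cov xa) : Dc p q ≤ Dc q p := by
  refine le_iInf fun γ => ?_
  rw [← cost_symm]
  exact Dc_le γ.2.symm

lemma Dc_comm (p q : Cov xa) : Dc p q = Dc q p := le_antisymm (Dc_comm_le _ _) (Dc_comm_le _ _)

lemma Dc_triangle (p q w : Cov xa) : Dc p w ≤ Dc p q + Dc q w := by
  unfold Dc
  rw [ENNReal.iInf_add]
  refine le_iInf fun γ => ?_
  rw [ENNReal.add_iInf]
  refine le_iInf fun γ' => ?_
  rw [← cost_trans]
  exact Dc_le (γ.2.trans γ'.2)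

instance : PseudoMetricSpace (Cov xa) where
  dist p q := (min (Dc p q) 1).toReal
  dist_self p := by simp [Dc_self]
  dist_comm p q := by simp [Dc_comm p q]
  dist_triangle p q w := by
    rw [← ENNReal.toReal_add (by simp) (by simp)]
    apply ENNReal.toReal_mono (by simp)
    rcases le_total (Dc p q) 1 with h | h
    · rcases le_total (Dc q w) 1 with h' | h'
      · rw [min_eq_left h, min_eq_left h']
        exact (min_le_left _ _).trans (Dc_triangle _ _ _)
      · rw [min_eq_right h']
        exact (min_le_right _ _).trans le_add_self
    · rw [min_eq_right h]
      exact (min_le_right _ _).trans le_self_add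

lemma dist_def (p q : Cov xa) : dist p q = (min (Dc p q) 1).toReal := rfl

lemma dist_le_of_Dc {p q : Cov xa} {c : ℝ} (hc : 0 ≤ c) (h : Dc p q ≤ ENNReal.ofReal c) :
    dist p q ≤ c := by
  rw [dist_def]
  exact ENNReal.toReal_le_of_le_ofReal hc ((min_le_left _ _).trans h)

lemma Dc_eq_of_dist {p q : Cov xa} (h : dist p q < 1) : Dc p q = ENNReal.ofReal (dist p q) := by
  rw [dist_def] at *
  rw [ENNReal.ofReal_toReal (by simp)]
  rcases le_total (Dc p q) 1 with h' | h'
  · rw [min_eq_left h']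
  · rw [min_eq_right h'] at h; simp at h

lemma dist_eq_of_Dc {p q : Cov xa} {c : ℝ} (hc : 0 ≤ c) (hc1 : c ≤ 1)
    (h : Dc p q = ENNReal.ofReal c) : dist p q = c := by
  rw [dist_def, h, min_eq_left (by simpa using hc1), ENNReal.toReal_ofReal hc]

lemma path_in_ball {x y : X} {γ : Path x y} {δ : ℝ} (h : cost γ < ENNReal.ofReal δ)
    (t : unitInterval) : ‖(γ t : E2) - x‖ < δ := by
  have := (norm_le_cost γ t).trans_lt h
  rw [norm_sub_rev]
  exact (ENNReal.ofReal_lt_ofReal_iff_of_nonneg (norm_nonneg _)).1 this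

/-- all small paths are links -/
lemma lk_ball {v : E2} {r : ℝ} {C : Set E2} (h : LocCone X v r C) {p q w : Cov xa}
    {γ : Path p.1 q.1} {γ' : Path p.1 w.1} (hγ : Lk p q γ) (hγ' : Lk p w γ')
    (hb : ∀ t, ‖(γ t : E2) - v‖ < r) (hb' : ∀ t, ‖(γ' t : E2) - v‖ < r)
    (β : Path q.1 w.1) (hβ : ∀ t, ‖(β t : E2) - v‖ < r) : Lk q w β := by
  refine (hγ.symm.trans hγ').homotopic (h.homotopic _ _ ?_ hβ)
  intro t
  rw [Path.trans_apply]
  split_ifs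
  · exact hb _
  · exact hb' _

lemma exists_small_link {δ : ℝ} (hδ1 : δ ≤ 1) {p q : Cov xa} (hd : dist p q < δ) :
    ∃ γ, Lk p q γ ∧ cost γ < ENNReal.ofReal δ := by
  apply exists_of_Dc_lt
  rw [Dc_eq_of_dist (hd.trans_le hδ1)]
  exact (ENNReal.ofReal_lt_ofReal_iff_of_nonneg dist_nonneg).2 hd

lemma loc_dist {v : E2} {r : ℝ} {C : Set E2} (h : LocCone X v r C) {δ : ℝ} (hδ1 : δ ≤ 1)
    {p q : Cov xa} (hd : dist p q < δ) (hball : ∀ y : E2, ‖y - p.1‖ < δ → ‖y - v‖ < r) :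
    dist p q = cd C (p.1 - v) (q.1 - v) := by
  obtain ⟨γ, hγ, hc⟩ := exists_small_link hδ1 hd
  have hb : ∀ t, ‖(γ t : E2) - v‖ < r := fun t => hball _ (path_in_ball hc t)
  have hcd := h.cd_le_cost γ hb
  have hlt : cd C (p.1 - v) (q.1 - v) < δ :=
    (ENNReal.ofReal_lt_ofReal_iff_of_nonneg (cd_nonneg _ _ _)).1 (hcd.trans_lt hc)
  apply dist_eq_of_Dc (cd_nonneg _ _ _) (hlt.le.trans hδ1)
  apply le_antisymm
  · have h0 := hb 0
    have h1 := hb 1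
    rw [γ.source] at h0
    rw [γ.target] at h1
    obtain ⟨β, hβ, hβc⟩ := h.exists_path p.1 q.1 h0 h1
    exact (Dc_le (hγ.homotopic (h.homotopic _ _ hb hβ))).trans hβc
  · refine le_iInf fun β => ?_
    by_cases hβ : cost β.1 < ENNReal.ofReal δ
    · exact h.cd_le_cost β.1 (fun t => hball _ (path_in_ball hβ t))
    · exact (hcd.trans hc.le).trans (not_lt.1 hβ)

/-- the local CN inequality -/
lemma local_CN (hcomp : IsCompact X)
    (hpoly : ∃ (n : ℕ) (P : Fin n → Finset E2), X = ⋃ i, convexHull ℝ (↑(P i) : Set E2)) :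
    ∃ δ > 0, δ ≤ 1 ∧ ∀ (xa : X) (p q : Cov xa), dist p q < δ → ∃ m, IsMid δ p q m := by
  obtain ⟨δ', hδ', hleb⟩ := exists_lebesgue hcomp hpoly one_pos
  refine ⟨min (δ' / 2) 1, by positivity, min_le_right _ _, ?_⟩
  set δ := min (δ' / 2) 1 with hδ
  have hδ1 : δ ≤ 1 := min_le_right _ _
  have hδ2 : δ ≤ δ' / 2 := min_le_left _ _
  have hδ0 : 0 < δ := by positivity
  intro xa p q hpq
  obtain ⟨v, r, C, h, -, hball⟩ := hleb p.1 p.1.2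
  have hbp : ∀ y : E2, ‖y - p.1‖ < δ → ‖y - v‖ < r := fun y hy => hball y (by linarith)
  -- everything close to p is linked inside the ball
  have link : ∀ w : Cov xa, dist p w < δ → ∃ γ, Lk p w γ ∧ (∀ t, ‖(γ t : E2) - v‖ < r) := by
    intro w hw
    obtain ⟨γ, hγ, hc⟩ := exists_small_link hδ1 hw
    exact ⟨γ, hγ, fun t => hbp _ (path_in_ball hc t)⟩
  have near : ∀ w : Cov xa, dist p w < δ → ‖(w.1 : E2) - p.1‖ < δ := by
    intro w hw
    obtain ⟨γ, hγ, hc⟩ := exists_small_link hδ1 hw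
    have := path_in_ball hc 1
    rwa [γ.target] at this
  have hpv : ‖(p.1 : E2) - v‖ < r := hbp _ (by simpa using hδ0)
  have hqv : ‖(q.1 : E2) - v‖ < r := hbp _ (near q hpq)
  obtain ⟨m₀, hm₀, hm₀n, hm1, hm2, hm3⟩ := cone_CN h.cn ((h.mem' hpv).1 p.1.2) ((h.mem' hqv).1 q.1.2)
  have hm₀r : ‖m₀‖ < r := hm₀n.trans_lt (max_lt hpv hqv)
  let m : X := ⟨v + m₀, (h.mem m₀ hm₀r).2 hm₀⟩
  have hmv : (m : E2) - v = m₀ := by simp [m]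
  have hmr : ‖(m : E2) - v‖ < r := by rwa [hmv]
  obtain ⟨γm, hγm, -⟩ := h.exists_path p.1 m hpv hmr
  let M : Cov xa := ⟨m, p.2.trans (Path.Homotopic.Quotient.mk γm)⟩
  have hM : Lk p M γm := rfl
  have dM : ∀ w : Cov xa, dist p w < δ → dist w M ≤ cd C (w.1 - v) m₀ := by
    intro w hw
    obtain ⟨γ, hγ, hb⟩ := link w hw
    have hwv : ‖(w.1 : E2) - v‖ < r := hbp _ (near w hw)
    obtain ⟨β, hβ, hβc⟩ := h.exists_path w.1 m hwv hmr
    have : Lk w M β := lk_ball h hγ hM hb hγm β hβ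
    rw [hmv] at hβc
    exact dist_le_of_Dc (cd_nonneg _ _ _) ((Dc_le this).trans hβc)
  have dw : ∀ w u : Cov xa, dist p w < δ → dist w u < δ →
      dist w u = cd C (w.1 - v) (u.1 - v) := by
    intro w u hw hu
    refine loc_dist h hδ1 hu (fun y hy => hball y ?_)
    have := near w hw
    calc ‖y - p.1‖ = ‖(y - w.1) + (w.1 - p.1)‖ := by congr 1; abel
      _ ≤ ‖y - w.1‖ + ‖(w.1 : E2) - p.1‖ := norm_add_le _ _
      _ < δ' := by linarith
  have hpp : dist p p < δ := by simpa using hδ0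
  have epq := dw p q hpp hpq
  refine ⟨M, ?_, ?_, ?_⟩
  · rw [epq]; exact (dM p hpp).trans hm1
  · rw [epq]; exact (dM q hpq).trans hm2
  · intro w hwp hwq
    have hpw : dist p w < δ := by rwa [dist_comm]
    have hwv : ‖(w.1 : E2) - v‖ < r := hbp _ (near w hpw)
    rw [epq, dw w p hpw hwp, dw w q hpw hwq]
    have := hm3 _ ((h.mem' hwv).1 w.1.2)
    refine le_trans ?_ this
    exact pow_le_pow_left₀ dist_nonneg (dM w hpw) 2

end cov

/-! ### The lifted optimal path -/

lemma homotopic_of_factor {Z Y : Type*} [TopologicalSpace Z] [SimplyConnectedSpace Z]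
    [TopologicalSpace Y] (f : C(Z, Y)) {x y : Y} {z₀ z₁ : Z} (p q : Path x y) (p' q' : Path z₀ z₁)
    (hp : ∀ t, p t = f (p' t)) (hq : ∀ t, q t = f (q' t)) : p.Homotopic q := by
  have hx : x = f z₀ := by rw [← p.source, hp, p'.source]
  have hy : y = f z₁ := by rw [← p.target, hp, p'.target]
  subst hx
  subst hy
  have h := (SimplyConnectedSpace.paths_homotopic p' q').map f
  have e1 : p = p'.map f.continuous := by ext t; simp [hp]
  have e2 : q = q'.map f.continuous := by ext t; simp [hq]
  rw [e1, e2]; exact h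

lemma simply_unit : SimplyConnectedSpace unitInterval := by
  have : ContractibleSpace (Set.Icc (0:ℝ) 1) :=
    (convex_Icc (0:ℝ) 1).contractibleSpace ⟨0, by simp⟩
  have : ContractibleSpace unitInterval := this
  infer_instance

def upath (t₁ t₂ : unitInterval) : Path t₁ t₂ where
  toFun s := ⟨(1 - s.1) * t₁.1 + s.1 * t₂.1, subIcc_mem s t₁ t₂⟩
  continuous_toFun := Continuous.subtype_mk (by fun_prop) _
  source' := Subtype.ext (by simp)
  target' := Subtype.ext (by simp)

section lift
variable {X : Set E2} {xa xb xc : X} (σs : Path xa xb) (σstar : Path xb xc)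

def obase (xa : X) : Cov xa := ⟨xa, Path.Homotopic.Quotient.refl xa⟩

def bbase : Cov xa := ⟨xb, Path.Homotopic.Quotient.mk σs⟩

def sg (t : unitInterval) : Cov xa :=
  ⟨σstar t, Path.Homotopic.Quotient.mk (σs.trans (subpath0 σstar t))⟩

def sgEnd : Cov xa := ⟨xc, Path.Homotopic.Quotient.mk (σs.trans σstar)⟩

lemma lk_obase {q : Cov xa} {γ : Path xa q.1} :
    Lk (obase xa) q γ ↔ Path.Homotopic.Quotient.mk γ = q.2 := by
  unfold Lk obase
  rw [Path.Homotopic.Quotient.refl_trans]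

lemma Lk.cancel {p q : Cov xa} {γ γ' : Path p.1 q.1} (h : Lk p q γ) (h' : Lk p q γ') :
    γ.Homotopic γ' := by
  unfold Lk at *
  rw [← h'] at h
  have := congrArg (fun z => p.2.symm.trans z) h
  simp only [← Path.Homotopic.Quotient.trans_assoc, Path.Homotopic.Quotient.symm_trans,
    Path.Homotopic.Quotient.refl_trans] at this
  exact Path.Homotopic.Quotient.eq.1 this

lemma mCost_eq (t : unitInterval) :
    mCost (σs.trans (subpath0 σstar t)) = Dc (obase xa) (sg σs σstar t) := by
  apply le_antisymm
  · refine le_iInf fun γ => ?_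
    refine iInf_le_of_le ⟨γ.1, ?_⟩ le_rfl
    have := lk_obase.1 γ.2
    exact (Path.Homotopic.Quotient.eq.1 this).symm
  · refine le_iInf fun γ => ?_
    exact Dc_le (lk_obase.2 (Path.Homotopic.Quotient.eq.2 γ.2.symm))

lemma lk_b_sg (t : unitInterval) : Lk (bbase σs) (sg σs σstar t) (subpath0 σstar t) := rfl

lemma lk_b_end : Lk (bbase σs) (sgEnd σs σstar) σstar := rfl

lemma lk_sg (s t : unitInterval) :
    Lk (sg σs σstar s) (sg σs σstar t) (subpath σstar s t) := by
  have := simply_unit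
  have hh : ((subpath0 σstar s).trans (subpath σstar s t)).Homotopic (subpath0 σstar t) := by
    refine homotopic_of_factor ⟨σstar, σstar.continuous⟩ _ _
      ((upath 0 s).trans (upath s t)) (upath 0 t) ?_ ?_
    · intro u
      rw [Path.trans_apply]
      change _ = σstar (((upath 0 s).trans (upath s t)) u)
      rw [Path.trans_apply]
      split_ifs <;> rfl
    · intro u; rfl
  change (Path.Homotopic.Quotient.mk (σs.trans (subpath0 σstar s))).trans
    (Path.Homotopic.Quotient.mk (subpath σstar s t)) =
    Path.Homotopic.Quotient.mk (σs.trans (subpath0 σstar t))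
  rw [Path.Homotopic.Quotient.mk_trans, Path.Homotopic.Quotient.trans_assoc,
    ← Path.Homotopic.Quotient.mk_trans (subpath0 σstar s), Path.Homotopic.Quotient.eq.2 hh,
    ← Path.Homotopic.Quotient.mk_trans]

lemma lk_sg_end (t : unitInterval) :
    Lk (sg σs σstar t) (sgEnd σs σstar) ((subpath σstar t 1).cast rfl σstar.target.symm) := by
  have := simply_unit
  have hh : ((subpath0 σstar t).trans ((subpath σstar t 1).cast rfl σstar.target.symm)).Homotopic
      σstar := by
    refine homotopic_of_factor ⟨σstar, σstar.continuous⟩ _ _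
      ((upath 0 t).trans (upath t 1)) (upath 0 1) ?_ ?_
    · intro u
      rw [Path.trans_apply]
      change _ = σstar (((upath 0 t).trans (upath t 1)) u)
      rw [Path.trans_apply]
      split_ifs <;> rfl
    · intro u
      change σstar u = σstar (upath 0 1 u)
      congr 1
      apply Subtype.ext
      simp [upath]
  change (Path.Homotopic.Quotient.mk (σs.trans (subpath0 σstar t))).trans
    (Path.Homotopic.Quotient.mk ((subpath σstar t 1).cast rfl σstar.target.symm)) =
    Path.Homotopic.Quotient.mk (σs.trans σstar)
  rw [Path.Homotopic.Quotient.mk_trans, Path.Homotopic.Quotient.trans_assoc,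
    ← Path.Homotopic.Quotient.mk_trans (subpath0 σstar t), Path.Homotopic.Quotient.eq.2 hh,
    ← Path.Homotopic.Quotient.mk_trans]

variable {σs σstar}

lemma cost_subpath0 (t : unitInterval) :
    cost (subpath0 σstar t) = eVariationOn (fun t => (σstar t : E2)) (Set.Icc 0 t) :=
  cost_subpath σstar unitInterval.nonneg'

lemma evar_star (hfst : cost σstar ≠ ⊤)
    (hparam : ∀ t : unitInterval, cost (subpath0 σstar t) = ENNReal.ofReal t.1 * cost σstar)
    {s t : unitInterval} (h : s ≤ t) :
    eVariationOn (fun t => (σstar t : E2)) (Set.Icc s t) =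
      ENNReal.ofReal ((t.1 - s.1) * (cost σstar).toReal) := by
  have h' : s.1 ≤ t.1 := h
  have e := evar_add σstar (unitInterval.nonneg' : 0 ≤ s) h
  rw [← cost_subpath0, ← cost_subpath0, hparam, hparam] at e
  have hL : cost σstar = ENNReal.ofReal (cost σstar).toReal := (ENNReal.ofReal_toReal hfst).symm
  set L := (cost σstar).toReal with hLd
  have hL0 : 0 ≤ L := ENNReal.toReal_nonneg
  rw [hL, ← ENNReal.ofReal_mul s.2.1, ← ENNReal.ofReal_mul t.2.1] at e
  have e2 : ENNReal.ofReal (t.1 * L) = ENNReal.ofReal (s.1 * L) + ENNReal.ofReal ((t.1 - s.1) * L) := by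
    rw [← ENNReal.ofReal_add (mul_nonneg s.2.1 hL0) (mul_nonneg (by linarith) hL0)]
    congr 1; ring
  rw [e2] at e
  exact (ENNReal.add_right_inj ENNReal.ofReal_ne_top).1 e

lemma Dc_sg (hfst : cost σstar ≠ ⊤) (hopt : IsOptimal σstar)
    (hparam : ∀ t : unitInterval, cost (subpath0 σstar t) = ENNReal.ofReal t.1 * cost σstar)
    {s t : unitInterval} (h : s ≤ t) :
    Dc (sg σs σstar s) (sg σs σstar t) = ENNReal.ofReal ((t.1 - s.1) * (cost σstar).toReal) := by
  rw [← evar_star hfst hparam h]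
  apply le_antisymm
  · rw [← cost_subpath σstar h]
    exact Dc_le (lk_sg σs σstar s t)
  · refine le_iInf fun β => ?_
    have hl := ((lk_b_sg σs σstar s).trans β.2).trans (lk_sg_end σs σstar t)
    have hh := hopt _ ((lk_b_end σs σstar).cancel hl)
    replace hh : cost σstar ≤ cost (subpath0 σstar s) + cost β.1 + cost (subpath σstar t 1) :=
      hh.trans_eq ((cost_trans _ _).trans (congrArg (· + _) (cost_trans _ _)))
    rw [cost_subpath0, cost_subpath σstar unitInterval.le_one',
      cost_split σstar t, ← evar_add σstar unitInterval.nonneg' h] at hh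
    have f1 : eVariationOn (fun t => (σstar t : E2)) (Set.Icc t 1) ≠ ⊤ := by
      rw [evar_star hfst hparam unitInterval.le_one']; exact ENNReal.ofReal_ne_top
    have f2 : eVariationOn (fun t => (σstar t : E2)) (Set.Icc 0 s) ≠ ⊤ := by
      rw [evar_star hfst hparam unitInterval.nonneg']; exact ENNReal.ofReal_ne_top
    have := (ENNReal.add_le_add_iff_right f1).1 hh
    exact (ENNReal.add_le_add_iff_left f2).1 this

lemma Dc_o_ne_top (hfs : cost σs ≠ ⊤) (hfst : cost σstar ≠ ⊤) (t : unitInterval) :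
    Dc (obase xa) (sg σs σstar t) ≠ ⊤ := by
  have : Dc (obase xa) (sg σs σstar t) ≤ cost (σs.trans (subpath0 σstar t)) :=
    Dc_le (lk_obase.2 rfl)
  rw [cost_trans, cost_subpath0] at this
  have h2 : eVariationOn (fun t => (σstar t : E2)) (Set.Icc 0 t) ≤ cost σstar := by
    rw [cost_split σstar t]; exact le_self_add
  exact ne_top_of_le_ne_top (ENNReal.add_ne_top.2 ⟨hfs, ne_top_of_le_ne_top hfst h2⟩) this

lemma Dc_lip (hfs : cost σs ≠ ⊤) (hfst : cost σstar ≠ ⊤) (hopt : IsOptimal σstar)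
    (hparam : ∀ t : unitInterval, cost (subpath0 σstar t) = ENNReal.ofReal t.1 * cost σstar)
    (s t : unitInterval) :
    (Dc (obase xa) (sg σs σstar t)).toReal ≤
      (Dc (obase xa) (sg σs σstar s)).toReal + |t.1 - s.1| * (cost σstar).toReal := by
  have key : Dc (sg σs σstar s) (sg σs σstar t) = ENNReal.ofReal (|t.1 - s.1| * (cost σstar).toReal) := by
    rcases le_total s t with h | h
    · have h' : s.1 ≤ t.1 := h
      rw [Dc_sg hfst hopt hparam h, abs_of_nonneg (by linarith)]
    · have h' : t.1 ≤ s.1 := h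
      rw [Dc_comm, Dc_sg hfst hopt hparam h, abs_of_nonpos (by linarith)]
      congr 2; ring
  have tri := Dc_triangle (obase xa) (sg σs σstar s) (sg σs σstar t)
  rw [key] at tri
  have h1 := ENNReal.toReal_mono (ENNReal.add_ne_top.2 ⟨Dc_o_ne_top hfs hfst s, ENNReal.ofReal_ne_top⟩) tri
  rwa [ENNReal.toReal_add (Dc_o_ne_top hfs hfst s) ENNReal.ofReal_ne_top,
    ENNReal.toReal_ofReal (mul_nonneg (abs_nonneg _) ENNReal.toReal_nonneg)] at h1

lemma isMid_sg (hfst : cost σstar ≠ ⊤) (hopt : IsOptimal σstar)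
    (hparam : ∀ t : unitInterval, cost (subpath0 σstar t) = ENNReal.ofReal t.1 * cost σstar)
    {δ : ℝ} (hδ1 : δ ≤ 1) (hCN : ∀ p q : Cov xa, dist p q < δ → ∃ m, IsMid δ p q m)
    {r s t : unitInterval} (h1 : r ≤ s) (h2 : s ≤ t) (hs : s.1 - r.1 = t.1 - s.1)
    (hd : (t.1 - r.1) * (cost σstar).toReal < δ) :
    IsMid δ (sg σs σstar r) (sg σs σstar t) (sg σs σstar s) := by
  have h1' : r.1 ≤ s.1 := h1
  have h2' : s.1 ≤ t.1 := h2
  have hL : 0 ≤ (cost σstar).toReal := ENNReal.toReal_nonneg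
  have e1 : dist (sg σs σstar r) (sg σs σstar t) = (t.1 - r.1) * (cost σstar).toReal :=
    dist_eq_of_Dc (mul_nonneg (by linarith) hL) (by linarith) (Dc_sg hfst hopt hparam (h1.trans h2))
  have e2 : dist (sg σs σstar r) (sg σs σstar s) = (s.1 - r.1) * (cost σstar).toReal :=
    dist_eq_of_Dc (mul_nonneg (by linarith) hL) (by nlinarith) (Dc_sg hfst hopt hparam h1)
  have e3 : dist (sg σs σstar s) (sg σs σstar t) = (t.1 - s.1) * (cost σstar).toReal :=
    dist_eq_of_Dc (mul_nonneg (by linarith) hL) (by nlinarith) (Dc_sg hfst hopt hparam h2)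
  obtain ⟨m, hm⟩ := hCN _ _ (e1 ▸ hd)
  refine isMid_of_dist hm (e1 ▸ hd) ?_ ?_
  · rw [e1, e2, show t.1 - r.1 = 2 * (s.1 - r.1) by linarith]; ring
  · rw [dist_comm, e1, e3, show t.1 - r.1 = 2 * (t.1 - s.1) by linarith]; ring

end lift

/-! ### The initial array -/

section arr
variable {X : Set E2} {xa : X}

abbrev pj (s : ℝ) : unitInterval := Set.projIcc (0:ℝ) 1 zero_le_one s

lemma pj_val {s : ℝ} (h0 : 0 ≤ s) (h1 : s ≤ 1) : (pj s : ℝ) = s := by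
  rw [pj, Set.projIcc_of_mem zero_le_one ⟨h0, h1⟩]

lemma exists_F {xd : X} {p q : Path xa xd} (h : p.Homotopic q) :
    ∃ F : C(ℝ × ℝ, X), UniformContinuous F ∧ (∀ s, F (0, s) = p (pj s)) ∧
      (∀ s, F (1, s) = q (pj s)) ∧ (∀ r, F (r, 0) = xa) ∧ (∀ r, F (r, 1) = xd) := by
  obtain ⟨H⟩ := h
  have hpc : UniformContinuous pj := (LipschitzWith.projIcc zero_le_one).uniformContinuous
  have hH : UniformContinuous H := CompactSpace.uniformContinuous_of_continuous H.continuous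
  have hu : UniformContinuous (fun z : ℝ × ℝ => H (pj z.1, pj z.2)) :=
    hH.comp ((hpc.comp uniformContinuous_fst).prodMk (hpc.comp uniformContinuous_snd))
  have p0 : pj 0 = 0 := Subtype.ext (pj_val le_rfl zero_le_one)
  have p1 : pj 1 = 1 := Subtype.ext (pj_val zero_le_one le_rfl)
  refine ⟨⟨_, hu.continuous⟩, hu, ?_, ?_, ?_, ?_⟩
  · intro s; simp [p0]
  · intro s; simp [p1]
  · intro r; simp [p0]
  · intro r; simp [p1]

def zl (z z' : ℝ × ℝ) : Path z z' where
  toFun s := (1 - s.1) • z + s.1 • z'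
  continuous_toFun := by fun_prop
  source' := by simp
  target' := by simp

lemma zl_apply (z z' : ℝ × ℝ) (s : unitInterval) : zl z z' s = (1 - s.1) • z + s.1 • z' := rfl

lemma Lk.eq_of_pointwise {p q q' : Cov xa} {γ : Path p.1 q.1} {γ' : Path p.1 q'.1} (h : Lk p q γ)
    (h' : Lk p q' γ') (hh : ∀ t, γ t = γ' t) : q = q' := by
  have hq : q.1 = q'.1 := by rw [← γ.target, hh, γ'.target]
  refine h.unique h' hq ?_
  have : γ = γ'.cast rfl hq := by ext t; simp [hh]
  rw [← this]

def yt (F : C(ℝ × ℝ, X)) (h : F (0, 0) = xa) (z : ℝ × ℝ) : Cov xa :=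
  ⟨F z, Path.Homotopic.Quotient.mk (((zl (0, 0) z).map F.continuous).cast h.symm rfl)⟩

variable {F : C(ℝ × ℝ, X)} {h : F (0, 0) = xa}

lemma lk_o_yt {z : ℝ × ℝ} (β : Path ((0, 0) : ℝ × ℝ) z) :
    Lk (obase xa) (yt F h z) ((β.map F.continuous).cast h.symm rfl) := by
  apply lk_obase.2
  apply Path.Homotopic.Quotient.eq.2
  exact homotopic_of_factor F _ _ β (zl (0, 0) z) (fun _ => rfl) (fun _ => rfl)

lemma lk_yt {z z' : ℝ × ℝ} (β : Path z z') :
    Lk (yt F h z) (yt F h z') (β.map F.continuous) := by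
  have h1 := lk_o_yt (F := F) (h := h) (zl (0, 0) z)
  have h2 := lk_o_yt (F := F) (h := h) ((zl (0, 0) z).trans β)
  have h3 : Lk (yt F h z) (yt F h z') (((((zl (0, 0) z).map F.continuous).cast h.symm rfl :
      Path xa (F z)).symm).trans
      ((((zl (0, 0) z).trans β).map F.continuous).cast h.symm rfl : Path xa (F z'))) := h1.symm.trans h2
  refine h3.homotopic ?_
  refine homotopic_of_factor F _ _ ((zl (0, 0) z).symm.trans ((zl (0, 0) z).trans β)) β ?_ (fun _ => rfl)
  intro t
  rw [Path.trans_apply ((zl (0, 0) z).symm)]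
  erw [Path.trans_apply]
  split_ifs <;> rfl

lemma Dc_yt_le {z z' : ℝ × ℝ} {c d : X} (γ : Path c d) {s t : unitInterval} (hst : s ≤ t)
    (he : ∀ u : unitInterval, F (zl z z' u) = γ (upath s t u)) :
    Dc (yt F h z) (yt F h z') ≤ eVariationOn (fun t => (γ t : E2)) (Set.Icc s t) := by
  refine (Dc_le (lk_yt (zl z z'))).trans (le_of_eq ?_)
  exact cost_of_affine ((zl z z').map F.continuous) γ hst he

lemma yt_small (hcomp : IsCompact X)
    (hpoly : ∃ (n : ℕ) (P : Fin n → Finset E2), X = ⋃ i, convexHull ℝ (↑(P i) : Set E2))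
    (hu : UniformContinuous F) {η : ℝ} (hη : 0 < η) :
    ∃ ρ > 0, ∀ z z' : ℝ × ℝ, dist z z' < ρ → dist (yt F h z) (yt F h z') ≤ η := by
  obtain ⟨δ, hδ, hl⟩ := exists_lebesgue hcomp hpoly (half_pos hη)
  obtain ⟨ρ, hρ, hρ'⟩ := Metric.uniformContinuous_iff.1 hu δ hδ
  refine ⟨ρ, hρ, fun z z' hz => ?_⟩
  obtain ⟨v, r, C, hC, hr, hb⟩ := hl (F z) (F z).2
  have hin : ∀ t, ‖((F (zl z z' t) : X) : E2) - v‖ < r := by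
    intro t
    apply hb
    have : dist (zl z z' t) z < ρ := by
      refine lt_of_le_of_lt ?_ hz
      have e : zl z z' t - z = t.1 • (z' - z) := by rw [zl_apply]; module
      rw [dist_eq_norm, e, norm_smul, Real.norm_of_nonneg t.2.1, dist_comm, dist_eq_norm]
      nlinarith [t.2.2, norm_nonneg (z' - z)]
    have := hρ' this
    rwa [Subtype.dist_eq, dist_eq_norm] at this
  have h0 := hin 0
  have h1 := hin 1
  rw [Path.source] at h0
  rw [Path.target] at h1
  obtain ⟨γ, hγ, hγc⟩ := hC.exists_path (F z) (F z') h0 h1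
  have hlk : Lk (yt F h z) (yt F h z') γ :=
    (lk_yt (zl z z')).homotopic (hC.homotopic ((zl z z').map F.continuous) γ hin hγ)
  apply dist_le_of_Dc hη.le
  refine (Dc_le hlk).trans (hγc.trans (ENNReal.ofReal_le_ofReal ?_))
  have := cd_le C ((F z : E2) - v) (F z' - v)
  linarith

def Qp (r u : ℝ) : ℝ × ℝ := (r * min 1 (2 - u), (1/2 + r/2) * min 1 u)

lemma Qp_dist_u {r : ℝ} (h0 : 0 ≤ r) (h1 : r ≤ 1) (u u' : ℝ) : dist (Qp r u) (Qp r u') ≤ |u - u'| := by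
  rw [Prod.dist_eq, Real.dist_eq, Real.dist_eq]
  have a1 : |min 1 (2 - u) - min 1 (2 - u')| ≤ |u - u'| := by
    have := abs_min_sub_min_le_max (1:ℝ) (2 - u) 1 (2 - u')
    have e : (2 - u) - (2 - u') = -(u - u') := by ring
    rw [e, abs_neg, sub_self, abs_zero, max_eq_right (abs_nonneg _)] at this
    exact this
  have a2 : |min 1 u - min 1 u'| ≤ |u - u'| := by
    have := abs_min_sub_min_le_max (1:ℝ) u 1 u'
    rw [sub_self, abs_zero, max_eq_right (abs_nonneg _)] at this
    exact this
  apply max_le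
  · simp only [Qp]
    rw [← mul_sub, abs_mul, abs_of_nonneg h0]
    nlinarith [abs_nonneg (min 1 (2 - u) - min 1 (2 - u'))]
  · simp only [Qp]
    rw [← mul_sub, abs_mul, abs_of_nonneg (by linarith)]
    nlinarith [abs_nonneg (min 1 u - min 1 u')]

lemma Qp_dist_r (r r' : ℝ) {u : ℝ} (h0 : 0 ≤ u) (h2 : u ≤ 2) : dist (Qp r u) (Qp r' u) ≤ |r - r'| := by
  rw [Prod.dist_eq, Real.dist_eq, Real.dist_eq]
  have b1 : 0 ≤ min 1 (2 - u) := le_min zero_le_one (by linarith)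
  have b2 : min 1 (2 - u) ≤ 1 := min_le_left _ _
  have b3 : 0 ≤ min 1 u := le_min zero_le_one h0
  have b4 : min 1 u ≤ 1 := min_le_left _ _
  apply max_le
  · simp only [Qp]
    rw [← sub_mul, abs_mul, abs_of_nonneg b1]
    nlinarith [abs_nonneg (r - r')]
  · simp only [Qp]
    rw [← sub_mul, abs_mul, abs_of_nonneg b3, show 1/2 + r/2 - (1/2 + r'/2) = (r - r') / 2 by ring,
      abs_div, abs_two]
    nlinarith [abs_nonneg (r - r')]

lemma sum_evar {c d : X} (γ : Path c d) (n : ℕ) (hn : 0 < n) :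
    ∑ i ∈ Finset.range n, eVariationOn (fun t => (γ t : E2))
      (Set.Icc (pj (i / n)) (pj ((i + 1 : ℕ) / n))) = cost γ := by
  have hm : Monotone (fun i : ℕ => pj ((i : ℝ) / n)) := by
    intro i j hij
    apply Set.monotone_projIcc
    gcongr
  have key : ∀ k : ℕ, ∑ i ∈ Finset.range k, eVariationOn (fun t => (γ t : E2))
      (Set.Icc (pj (i / n)) (pj ((i + 1 : ℕ) / n))) =
      eVariationOn (fun t => (γ t : E2)) (Set.Icc 0 (pj (k / n))) := by
    intro k
    induction k with
    | zero =>
      have : pj (((0:ℕ):ℝ) / n) = 0 := Subtype.ext (by simpa using pj_val le_rfl zero_le_one)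
      rw [this]; simp
    | succ k ih =>
      rw [Finset.sum_range_succ, ih, evar_add γ unitInterval.nonneg' (hm (Nat.le_succ k))]
  rw [key n]
  have : pj ((n:ℝ) / n) = 1 := by
    have hn' : (n:ℝ) ≠ 0 := by exact_mod_cast hn.ne'
    rw [div_self hn']; exact Subtype.ext (pj_val zero_le_one le_rfl)
  rw [this, cost_eq_Icc]

lemma Dc_ofReal_dist (p q : Cov xa) : ENNReal.ofReal (dist p q) ≤ Dc p q := by
  rw [dist_def, ENNReal.ofReal_toReal (by simp)]
  exact min_le_left _ _

lemma len_bound {c d : X} (γ : Path c d) (hγ : cost γ ≠ ⊤) (n : ℕ) (hn : 0 < n) (y : ℕ → Cov xa)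
    (h1 : ∀ i < n, Dc (y i) (y (i+1)) ≤ eVariationOn (fun t => (γ t : E2))
      (Set.Icc (pj (i / n)) (pj ((i + 1 : ℕ) / n))))
    (h2 : ∀ i, n ≤ i → i < n + n → Dc (y i) (y (i+1)) = 0) :
    Len (n + n) y ≤ (cost γ).toReal := by
  unfold Len
  rw [Finset.sum_range_add]
  have e2 : ∑ x ∈ Finset.range n, dist (y (n + x)) (y (n + x + 1)) = 0 := by
    apply Finset.sum_eq_zero
    intro x hx
    have := h2 (n + x) (by omega) (by have := Finset.mem_range.1 hx; omega)
    rw [dist_def, this]; simp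
  rw [e2, add_zero]
  apply (ENNReal.ofReal_le_iff_le_toReal hγ).1
  rw [ENNReal.ofReal_sum_of_nonneg (fun _ _ => dist_nonneg), ← sum_evar γ n hn]
  apply Finset.sum_le_sum
  intro i hi
  exact (Dc_ofReal_dist _ _).trans (h1 i (Finset.mem_range.1 hi))

end arr

section fin
variable {X : Set E2} {xa xb xc : X}

lemma trans_lo {Y : Type*} [TopologicalSpace Y] {x y z : Y} (p : Path x y) (q : Path y z)
    (s : unitInterval) : (p.trans q) (pj (s.1 / 2)) = p s := by
  have h0 := s.2.1
  have h1 := s.2.2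
  have e := pj_val (s := s.1 / 2) (by linarith) (by linarith)
  rw [Path.trans_apply, dif_pos (by rw [e]; linarith)]
  congr 1
  apply Subtype.ext
  change 2 * (pj (s.1 / 2) : ℝ) = s.1
  rw [e]; ring

lemma trans_hi {Y : Type*} [TopologicalSpace Y] {x y z : Y} (p : Path x y) (q : Path y z)
    (s : unitInterval) : (p.trans q) (pj (1 / 2 + s.1 / 2)) = q s := by
  have h0 := s.2.1
  have h1 := s.2.2
  have e := pj_val (s := 1 / 2 + s.1 / 2) (by linarith) (by linarith)
  rw [Path.trans_apply]
  split_ifs with hh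
  · rw [e] at hh
    have hs : s = 0 := Subtype.ext (show s.1 = 0 by linarith)
    have hs0 : s.1 = 0 := by linarith
    have hq : q s = y := by rw [hs, q.source]
    rw [hq]
    convert p.target using 2
    apply Subtype.ext
    change 2 * (pj (1 / 2 + s.1 / 2) : ℝ) = 1
    rw [e, hs0]; norm_num
  · congr 1
    apply Subtype.ext
    change 2 * (pj (1 / 2 + s.1 / 2) : ℝ) - 1 = s.1
    rw [e]; ring

lemma array_exists (hcomp : IsCompact X)
    (hpoly : ∃ (n : ℕ) (P : Fin n → Finset E2), X = ⋃ i, convexHull ℝ (↑(P i) : Set E2))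
    (σs : Path xa xb) (σstar : Path xb xc) (a b : unitInterval)
    (c₁ : Path xa (σstar a)) (c₂ : Path xa (σstar b))
    (h₁ : Lk (obase xa) (sg σs σstar a) c₁) (h₂ : Lk (obase xa) (sg σs σstar b) c₂)
    (hc₁ : cost c₁ ≠ ⊤) (hc₂ : cost c₂ ≠ ⊤) {η : ℝ} (hη : 0 < η) :
    ∃ N₀ : ℝ, ∀ N : ℕ, N₀ < N → 0 < N → ∃ n > 0, ∃ y,
      Arr N n (obase xa) (fun j => sg σs σstar (upath a b (pj (j / N)))) η y ∧
      Len n (y 0) ≤ (cost c₁).toReal ∧ Len n (y N) ≤ (cost c₂).toReal := by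
  have hl : Lk (obase xa) (sg σs σstar b) (c₁.trans (subpath σstar a b)) :=
    h₁.trans (lk_sg σs σstar a b)
  have hom : (c₁.trans (subpath σstar a b)).Homotopic c₂ := hl.cancel h₂
  obtain ⟨F, hu, F0, F1, Fb, Ft⟩ := exists_F hom
  have h : F (0, 0) = xa := Fb 0
  obtain ⟨ρ, hρ, hsmall⟩ := yt_small (F := F) (h := h) hcomp hpoly hu hη
  have e0 : ∀ r, yt F h (r, 0) = obase xa := by
    intro r
    refine (lk_o_yt (zl (0, 0) (r, 0))).eq_of_pointwise (lk_refl (obase xa)) ?_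
    intro t
    change F (zl (0, 0) (r, 0) t) = xa
    have : zl (0, 0) (r, 0) t = (t.1 * r, 0) := by rw [zl_apply]; ext <;> simp
    rw [this, Fb]
  have e1 : ∀ r : unitInterval, yt F h (0, 1/2 + r.1/2) = sg σs σstar (upath a b r) := by
    intro r
    have k1 := lk_o_yt (F := F) (h := h)
      ((zl (0, 0) (0, 1/2)).trans (zl (0, 1/2) (0, 1/2 + r.1/2)))
    have k2 : Lk (obase xa) (sg σs σstar (upath a b r)) (c₁.trans (subpath σstar a (upath a b r))) :=
      h₁.trans (lk_sg σs σstar a (upath a b r))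
    refine k1.eq_of_pointwise k2 ?_
    intro t
    change F (((zl (0, 0) (0, 1/2)).trans (zl (0, 1/2) (0, 1/2 + r.1/2))) t) =
      (c₁.trans (subpath σstar a (upath a b r))) t
    rw [Path.trans_apply, Path.trans_apply]
    split_ifs with ht
    · rw [← trans_lo c₁ (subpath σstar a b), ← F0]
      congr 1
      rw [zl_apply]; ext <;> simp; ring
    · set w : unitInterval := ⟨2 * t.1 - 1, unitInterval.two_mul_sub_one_mem_iff.2 ⟨(not_le.1 ht).le, t.2.2⟩⟩
        with hw
      have : subpath σstar a (upath a b r) w = subpath σstar a b (w * r) := by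
        change σstar _ = σstar _
        congr 1
        apply Subtype.ext
        change (1 - w.1) * a.1 + w.1 * ((1 - r.1) * a.1 + r.1 * b.1) =
          (1 - w.1 * r.1) * a.1 + w.1 * r.1 * b.1
        ring
      rw [this, ← trans_hi c₁ (subpath σstar a b), ← F0]
      congr 1
      rw [zl_apply]
      ext
      · simp
      · simp; ring
  refine ⟨1 / ρ, fun N hN hN0 => ?_⟩
  have hNpos : (0:ℝ) < N := by exact_mod_cast hN0
  have hNρ : 1 / (N:ℝ) < ρ := by
    rw [div_lt_iff₀ hρ] at hN
    rw [div_lt_iff₀ hNpos]; linarith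
  have hNne : (N:ℝ) ≠ 0 := hNpos.ne'
  have hstep : ∀ i : ℕ, |((i:ℝ) / N) - ((i + 1 : ℕ) : ℝ) / N| < ρ := by
    intro i
    rw [← sub_div, abs_div, abs_of_pos hNpos]
    push_cast
    rw [show (i:ℝ) - (i + 1) = -1 by ring]
    simpa using hNρ
  have hr : ∀ j ≤ N, 0 ≤ (j:ℝ) / N ∧ (j:ℝ) / N ≤ 1 := by
    intro j hj
    refine ⟨by positivity, ?_⟩
    rw [div_le_one hNpos]; exact_mod_cast hj
  have hr2 : ∀ j ≤ N + N, 0 ≤ (j:ℝ) / N ∧ (j:ℝ) / N ≤ 2 := by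
    intro j hj
    refine ⟨by positivity, ?_⟩
    rw [div_le_iff₀ hNpos]
    have : (j:ℝ) ≤ N + N := by exact_mod_cast hj
    linarith
  have hr3 : ∀ j, N ≤ j → 1 ≤ (j:ℝ) / N := by
    intro j hj
    rw [le_div_iff₀ hNpos, one_mul]; exact_mod_cast hj
  refine ⟨N + N, by omega, fun j i => yt F h (Qp (j / N) (i / N)), ⟨?_, ?_, ?_, ?_⟩, ?_, ?_⟩
  · intro j hj
    have : Qp ((j:ℝ) / N) (((0:ℕ):ℝ) / N) = ((j:ℝ) / N * min 1 (2 - ((0:ℕ):ℝ) / N), 0) := by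
      simp [Qp]
    rw [this, e0]
  · intro j hj
    have h2 : ((N + N : ℕ) : ℝ) / N = 2 := by push_cast; field_simp; norm_num
    have e := pj_val (hr j hj).1 (hr j hj).2
    have : Qp ((j:ℝ) / N) (((N + N : ℕ):ℝ) / N) = (0, 1/2 + (pj ((j:ℝ) / N)).1 / 2) := by
      rw [h2]
      simp only [Qp, e]
      ext <;> norm_num
    change yt F h (Qp ((j:ℝ) / N) (((N + N : ℕ):ℝ) / N)) = _
    rw [this, e1]
  · intro j hj i hi
    exact hsmall _ _ ((Qp_dist_u (hr j hj).1 (hr j hj).2 _ _).trans_lt (hstep i))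
  · intro j hj i hi
    exact hsmall _ _ ((Qp_dist_r _ _ (hr2 i hi).1 (hr2 i hi).2).trans_lt (hstep j))
  · refine len_bound c₁ hc₁ N hN0 _ ?_ ?_
    · intro i hi
      have hm : pj ((i:ℝ) / N) ≤ pj (((i+1:ℕ):ℝ) / N) := by
        apply Set.monotone_projIcc; gcongr; omega
      refine Dc_yt_le c₁ hm ?_
      intro u
      rw [← trans_lo c₁ (subpath σstar a b), ← F0]
      congr 1
      have v1 := pj_val (hr i hi.le).1 (hr i hi.le).2
      have v2 := pj_val (hr (i+1) hi).1 (hr (i+1) hi).2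
      have v3 : (upath (pj ((i:ℝ) / N)) (pj (((i+1:ℕ):ℝ) / N)) u : ℝ) =
        (1 - u.1) * ((i:ℝ) / N) + u.1 * (((i+1:ℕ):ℝ) / N) := by
        change (1 - u.1) * (pj ((i:ℝ)/N) : ℝ) + u.1 * (pj (((i+1:ℕ):ℝ)/N) : ℝ) = _
        rw [v1, v2]
      rw [v3, zl_apply]
      simp only [Qp, min_eq_right (hr i hi.le).2, min_eq_right (hr (i+1) hi).2]
      ext
      · simp
      · simp; ring
    · intro i hi hi2
      have : Qp (((0:ℕ):ℝ) / N) ((i:ℝ) / N) = Qp (((0:ℕ):ℝ) / N) (((i+1:ℕ):ℝ) / N) := by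
        simp only [Qp, min_eq_left (hr3 i hi), min_eq_left (hr3 (i+1) (by omega))]
        simp
      change Dc (yt F h (Qp (((0:ℕ):ℝ)/N) ((i:ℝ)/N))) (yt F h (Qp (((0:ℕ):ℝ)/N) (((i+1:ℕ):ℝ)/N))) = 0
      rw [this, Dc_self]
  · refine len_bound c₂ hc₂ N hN0 _ ?_ ?_
    · intro i hi
      have hm : pj ((i:ℝ) / N) ≤ pj (((i+1:ℕ):ℝ) / N) := by
        apply Set.monotone_projIcc; gcongr; omega
      refine Dc_yt_le c₂ hm ?_
      intro u
      have v1 := pj_val (hr i hi.le).1 (hr i hi.le).2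
      have v2 := pj_val (hr (i+1) hi).1 (hr (i+1) hi).2
      set q := upath (pj ((i:ℝ) / N)) (pj (((i+1:ℕ):ℝ) / N)) u with hq
      have v3 : (q : ℝ) =
        (1 - u.1) * ((i:ℝ) / N) + u.1 * (((i+1:ℕ):ℝ) / N) := by
        change (1 - u.1) * (pj ((i:ℝ)/N) : ℝ) + u.1 * (pj (((i+1:ℕ):ℝ)/N) : ℝ) = _
        rw [v1, v2]
      have v4 : pj q.1 = q := Subtype.ext (pj_val q.2.1 q.2.2)
      rw [← v4, ← F1]
      congr 1
      rw [v3, zl_apply, div_self hNne]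
      have m1 := (hr i hi.le).2
      have m2 := (hr (i+1) hi).2
      simp only [Qp, min_eq_right m1, min_eq_right m2,
        min_eq_left (show (1:ℝ) ≤ 2 - (i:ℝ) / N by linarith),
        min_eq_left (show (1:ℝ) ≤ 2 - ((i+1:ℕ):ℝ) / N by linarith)]
      ext
      · simp
      · simp; ring
    · intro i hi hi2
      refine le_antisymm ?_ bot_le
      refine (Dc_yt_le (Path.refl (σstar b)) (le_refl 0) ?_).trans ?_
      · intro u
        change F _ = σstar b
        rw [zl_apply, div_self hNne]
        simp only [Qp, min_eq_left (hr3 i hi), min_eq_left (hr3 (i+1) (by omega))]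
        rw [← Ft ((1 - u.1) * min 1 (2 - (i:ℝ) / N) + u.1 * min 1 (2 - ((i+1:ℕ):ℝ) / N))]
        congr 1
        ext
        · simp
        · simp; ring
      · simp

lemma Dc_le_len (n : ℕ) (z : ℕ → Cov xa) (hz : ∀ i < n, dist (z i) (z (i+1)) < 1) :
    Dc (z 0) (z n) ≤ ENNReal.ofReal (Len n z) := by
  induction n with
  | zero => simp [Dc_self]
  | succ n ih =>
    have h1 := ih (fun i hi => hz i (by omega))
    unfold Len at *
    rw [Finset.sum_range_succ, ENNReal.ofReal_add (Finset.sum_nonneg (fun _ _ => dist_nonneg)) dist_nonneg]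
    refine (Dc_triangle _ (z n) _).trans (add_le_add h1 ?_)
    exact (Dc_eq_of_dist (hz n (by omega))).le

lemma exists_rep {q : Cov xa} (hq : Dc (obase xa) q ≠ ⊤) {ε : ℝ} (hε : 0 < ε) :
    ∃ γ : Path xa q.1, Lk (obase xa) q γ ∧ cost γ ≠ ⊤ ∧
      (cost γ).toReal ≤ (Dc (obase xa) q).toReal + ε := by
  have : Dc (obase xa) q < Dc (obase xa) q + ENNReal.ofReal ε :=
    ENNReal.lt_add_right hq (by simpa using hε)
  obtain ⟨γ, hγ, hc⟩ := exists_of_Dc_lt this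
  refine ⟨γ, hγ, hc.ne_top, ?_⟩
  have h := ENNReal.toReal_mono (ENNReal.add_ne_top.2 ⟨hq, ENNReal.ofReal_ne_top⟩) hc.le
  rwa [ENNReal.toReal_add hq ENNReal.ofReal_ne_top, ENNReal.toReal_ofReal hε.le] at h

set_option maxHeartbeats 1000000 in
lemma main_ineq (hcomp : IsCompact X)
    (hpoly : ∃ (n : ℕ) (P : Fin n → Finset E2), X = ⋃ i, convexHull ℝ (↑(P i) : Set E2))
    {σs : Path xa xb} {σstar : Path xb xc}
    (hfs : cost σs ≠ ⊤) (hfst : cost σstar ≠ ⊤) (hopt : IsOptimal σstar)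
    (hparam : ∀ t : unitInterval, cost (subpath0 σstar t) = ENNReal.ofReal t.1 * cost σstar)
    {a b : unitInterval} (hab : a ≤ b) (θ : unitInterval) :
    (Dc (obase xa) (sg σs σstar (upath a b θ))).toReal ≤
      (1 - θ.1) * (Dc (obase xa) (sg σs σstar a)).toReal +
        θ.1 * (Dc (obase xa) (sg σs σstar b)).toReal := by
  set G : unitInterval → ℝ := fun t => (Dc (obase xa) (sg σs σstar t)).toReal with hG
  have hlip := Dc_lip (xa := xa) hfs hfst hopt hparam
  set L := (cost σstar).toReal with hL
  have hL0 : 0 ≤ L := ENNReal.toReal_nonneg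
  have hab' : a.1 ≤ b.1 := hab
  have ha0 := a.2.1
  have hb1 := b.2.2
  obtain ⟨δ, hδ, hδ1, hCN⟩ := local_CN hcomp hpoly
  change G (upath a b θ) ≤ (1 - θ.1) * G a + θ.1 * G b
  apply le_of_forall_pos_le_add
  intro ε' hε'
  set ε := ε' / 3 with hε
  have hε0 : 0 < ε := by positivity
  obtain ⟨c₁, l₁, f₁, k₁⟩ := exists_rep (Dc_o_ne_top hfs hfst a) hε0
  obtain ⟨c₂, l₂, f₂, k₂⟩ := exists_rep (Dc_o_ne_top hfs hfst b) hε0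
  have hη : 0 < δ / 8 := by positivity
  obtain ⟨N₀, hN₀⟩ := array_exists hcomp hpoly σs σstar a b c₁ c₂ l₁ l₂ f₁ f₂ hη
  obtain ⟨N, hN⟩ := exists_nat_gt (max (max N₀ (2 * L / δ)) (max ((L + |G b - G a|) / ε) 0))
  have n1 : N₀ < N := lt_of_le_of_lt ((le_max_left _ _).trans (le_max_left _ _)) hN
  have n2 : 2 * L / δ < N := lt_of_le_of_lt ((le_max_right _ _).trans (le_max_left _ _)) hN
  have n3 : (L + |G b - G a|) / ε < N := lt_of_le_of_lt ((le_max_left _ _).trans (le_max_right _ _)) hN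
  have n4 : (0:ℝ) < N := lt_of_le_of_lt ((le_max_right _ _).trans (le_max_right _ _)) hN
  have n5 : 0 < N := by exact_mod_cast n4
  rw [div_lt_iff₀ hδ] at n2
  rw [div_lt_iff₀ hε0] at n3
  obtain ⟨n, hn, y, hy, y0, yN⟩ := hN₀ N n1 n5
  have e8 : 8 * (δ / 8) = δ := by ring
  have hval : ∀ j : ℕ, j ≤ N → ((upath a b (pj ((j:ℝ) / N)) : unitInterval) : ℝ) =
      (1 - (j:ℝ) / N) * a.1 + (j:ℝ) / N * b.1 := by
    intro j hj
    have : (pj ((j:ℝ) / N) : ℝ) = (j:ℝ) / N :=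
      pj_val (by positivity) (by rw [div_le_one n4]; exact_mod_cast hj)
    conv_rhs => rw [← this]
    rfl
  have hσ : ∀ j, j + 2 ≤ N → IsMid (8 * (δ / 8)) (sg σs σstar (upath a b (pj ((j:ℕ) / N))))
      (sg σs σstar (upath a b (pj ((j + 2 : ℕ) / N)))) (sg σs σstar (upath a b (pj ((j + 1 : ℕ) / N)))) := by
    intro j hj
    have v0 := hval j (by omega)
    have d1 : ((j+1:ℕ):ℝ) / N = (j:ℝ) / N + 1 / N := by push_cast; ring
    have d2 : ((j+2:ℕ):ℝ) / N = (j:ℝ) / N + 2 * (1 / N) := by push_cast; ring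
    have hi : 0 < 1 / (N:ℝ) := by positivity
    have hi' : 1 / (N:ℝ) * N = 1 := by field_simp
    have v1 : ((upath a b (pj (((j+1:ℕ):ℝ)/N)) : unitInterval) : ℝ) =
        (1 - ((j:ℝ)/N + 1/N)) * a.1 + ((j:ℝ)/N + 1/N) * b.1 := by
      rw [hval (j+1) (by omega), d1]
    have v2 : ((upath a b (pj (((j+2:ℕ):ℝ)/N)) : unitInterval) : ℝ) =
        (1 - ((j:ℝ)/N + 2 * (1/N))) * a.1 + ((j:ℝ)/N + 2 * (1/N)) * b.1 := by
      rw [hval (j+2) hj, d2]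
    rw [e8]
    refine isMid_sg hfst hopt hparam hδ1 (hCN xa) ?_ ?_ ?_ ?_
    · apply Subtype.coe_le_coe.1
      rw [v0, v1]; nlinarith
    · apply Subtype.coe_le_coe.1
      rw [v1, v2]; nlinarith
    · rw [v0, v1, v2]; ring
    · rw [v0, v2]
      have : (1 - ((j:ℝ) / N + 2 * (1 / N))) * a.1 + ((j:ℝ) / N + 2 * (1 / N)) * b.1 -
        ((1 - (j:ℝ) / N) * a.1 + (j:ℝ) / N * b.1) = 2 * (1 / N) * (b.1 - a.1) := by ring
      rw [this]
      have t1 : 2 * (1 / (N:ℝ)) * (b.1 - a.1) * L ≤ 2 * (1 / (N:ℝ)) * 1 * L := by gcongr; linarith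
      have t2 : 2 * (1 / (N:ℝ)) * 1 * L < δ := by
        rw [show 2 * (1 / (N:ℝ)) * 1 * L = 2 * L / N by ring, div_lt_iff₀ n4]; linarith
      linarith
  set j := ⌊θ.1 * N⌋₊ with hj
  have hθ0 := θ.2.1
  have hθ1 := θ.2.2
  have j1 : (j:ℝ) ≤ θ.1 * N := Nat.floor_le (by positivity)
  have j2 : θ.1 * N < j + 1 := Nat.lt_floor_add_one _
  have jN : j ≤ N := by
    have : (j:ℝ) ≤ N := by nlinarith
    exact_mod_cast this
  obtain ⟨z, z0, zn, zs, zl⟩ := flow (σ := fun j => sg σs σstar (upath a b (pj ((j:ℕ) / N))))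
    hη (by rw [e8]; exact hCN xa) n5 hn hσ hy ε hε0 j jN
  have hD := Dc_le_len n z (fun i hi => (zs i hi).trans_lt (by linarith))
  rw [z0, zn] at hD
  have Lnn : 0 ≤ Len n z := Finset.sum_nonneg (fun _ _ => dist_nonneg)
  have hGj : G (upath a b (pj ((j:ℝ) / N))) ≤ Len n z := ENNReal.toReal_le_of_le_ofReal Lnn hD
  set x : ℝ := (j:ℝ) / N with hx
  have x0 : 0 ≤ x := by positivity
  have x1 : x ≤ θ.1 := by rw [hx, div_le_iff₀ n4]; exact j1
  have x2 : θ.1 - x ≤ 1 / N := by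
    rw [hx, sub_le_iff_le_add, ← add_div, le_div_iff₀ n4]; linarith
  have hl := hlip (upath a b (pj x)) (upath a b θ)
  have hv := hval j jN
  have hθv : ((upath a b θ : unitInterval) : ℝ) = (1 - θ.1) * a.1 + θ.1 * b.1 := rfl
  rw [hv, hθv] at hl
  have habs : |(1 - θ.1) * a.1 + θ.1 * b.1 - ((1 - x) * a.1 + x * b.1)| ≤ 1 / N := by
    rw [show (1 - θ.1) * a.1 + θ.1 * b.1 - ((1 - x) * a.1 + x * b.1) = (θ.1 - x) * (b.1 - a.1) by ring,
      abs_of_nonneg (mul_nonneg (by linarith) (by linarith))]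
    nlinarith
  have hl' : G (upath a b θ) ≤ G (upath a b (pj x)) + 1 / N * L :=
    hl.trans (by gcongr)
  have r1 : (1 - x) * Len n (y 0) + x * Len n (y N) ≤ (1 - x) * (G a + ε) + x * (G b + ε) := by
    have : 0 ≤ 1 - x := by linarith
    have s1 : Len n (y 0) ≤ G a + ε := y0.trans k₁
    have s2 : Len n (y N) ≤ G b + ε := yN.trans k₂
    gcongr
  have r2 : (θ.1 - x) * (G a - G b) ≤ 1 / N * |G b - G a| := by
    rw [abs_sub_comm]
    calc (θ.1 - x) * (G a - G b) ≤ (θ.1 - x) * |G a - G b| := 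
          mul_le_mul_of_nonneg_left (le_abs_self _) (by linarith)
      _ ≤ _ := mul_le_mul_of_nonneg_right x2 (abs_nonneg _)
  have r3 : 1 / N * L + 1 / N * |G b - G a| ≤ ε := by
    rw [← mul_add, one_div, ← div_eq_inv_mul, div_le_iff₀ n4]; linarith
  have hε3 : ε' = 3 * ε := by rw [hε]; ring
  rw [hε3]
  have e1 : (1-x)*(G a+ε)+x*(G b+ε) = (1-x)*G a + x*G b + ε := by ring
  have e2 : (1-x)*G a + x*G b = (1-θ.1)*G a + θ.1*G b + (θ.1-x)*(G a - G b) := by ring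
  have e3 : Len n (y 0) + x*(Len n (y N) - Len n (y 0)) = (1-x)*Len n (y 0) + x*Len n (y N) := by ring
  linarith

end fin

/-- if the free space is compact, path-connected and a finite union of
convex polygons, and `σ*` is an optimal homotopic path parametrized proportionally to
arc length, then `g(t) = m[σ_s * σ*_{[0,t]}]` is convex on `[0,1]`. -/
theorem mcost_general_convexOn {X : Set E2} (hcomp : IsCompact X)
    (hpc : IsPathConnected X)
    (hpoly : ∃ (n : ℕ) (P : Fin n → Finset E2), X = ⋃ i, convexHull ℝ (↑(P i) : Set E2))
    {xa xb xc : X} (σs : Path xa xb) (σstar : Path xb xc)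
    (hfs : cost σs ≠ ⊤) (hfst : cost σstar ≠ ⊤) (hopt : IsOptimal σstar)
    (hparam : ∀ t : unitInterval,
      cost (subpath0 σstar t) = ENNReal.ofReal t.1 * cost σstar)
    (g : ℝ → ℝ)
    (hg : ∀ t : unitInterval, g t.1 = (mCost (σs.trans (subpath0 σstar t))).toReal) :
    ConvexOn ℝ (Set.Icc (0:ℝ) 1) g := by
  have key : ∀ t : unitInterval, g t.1 = (Dc (obase xa) (sg σs σstar t)).toReal := by
    intro t
    rw [hg t, mCost_eq σs σstar t]
  refine ⟨convex_Icc 0 1, ?_⟩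
  intro x hx y hy α β hα hβ hαβ
  have aux : ∀ (x : ℝ) (hx : x ∈ Set.Icc (0:ℝ) 1) (y : ℝ) (hy : y ∈ Set.Icc (0:ℝ) 1) (α β : ℝ),
      0 ≤ α → 0 ≤ β → α + β = 1 → x ≤ y → g (α * x + β * y) ≤ α * g x + β * g y := by
    intro x hx y hy α β hα hβ hαβ hxy
    have h := main_ineq (σs := σs) hcomp hpoly hfs hfst hopt hparam
      (a := ⟨x, hx⟩) (b := ⟨y, hy⟩) hxy ⟨β, hβ, by linarith⟩
    rw [← key, ← key, ← key] at h
    have hα' : α = 1 - β := by linarith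
    rw [hα']
    exact h
  simp only [smul_eq_mul]
  rcases le_total x y with hxy | hxy
  · exact aux x hx y hy α β hα hβ hαβ hxy
  · have := aux y hy x hx β α hβ hα (by linarith) hxy
    rw [add_comm (α * x), add_comm (α * g x)]
    exact this


end THPP
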